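/- arXiv:2411.01290 — 2 statements merged into one kernel-verified Lean document; each statement's English description precedes it below -/
import Mathlib

section
/- Let K ⊂ ℝⁿ be a convex body with 0 in its interior and let Φ be an n-dimensional Young function. Then for every ξ ∈ ℝⁿ \ {0}, the function s ↦ h_{{Φ_{•K} ≤ s}}(ξ) is concave, continuous, nonnegative and nondecreasing on [0,∞), where h_{{Φ_{•K} ≤ s}} is the support function of the sub-level set {Φ_{•K} ≤ s}. -/
open MeasureTheory Filter Set
open scoped ENNReal NNReal Topology Pointwise symmDiff RealInnerProductSpace

noncomputable section

/-- Euclidean space `ℝⁿ`. -/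
abbrev Euc (n : ℕ) := EuclideanSpace ℝ (Fin n)

/-- Convexity for `ℝ≥0∞`-valued functions on `ℝⁿ`. -/
def ConvexOnE {n : ℕ} (Φ : Euc n → ℝ≥0∞) : Prop :=
  ∀ x y : Euc n, ∀ a b : ℝ, 0 ≤ a → 0 ≤ b → a + b = 1 →
    Φ (a • x + b • y) ≤ ENNReal.ofReal a * Φ x + ENNReal.ofReal b * Φ y

/-- Strict convexity for `ℝ≥0∞`-valued functions on `ℝⁿ`. -/
def StrictConvexOnE {n : ℕ} (Φ : Euc n → ℝ≥0∞) : Prop :=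
  ∀ x y : Euc n, x ≠ y → ∀ a b : ℝ, 0 < a → 0 < b → a + b = 1 →
    Φ (a • x + b • y) < ENNReal.ofReal a * Φ x + ENNReal.ofReal b * Φ y

/-- An `n`-dimensional Young function: convex, lower semicontinuous, finite near `0`,
vanishing at `0`, tending to `∞` at infinity. -/
structure IsNYoung {n : ℕ} (Φ : Euc n → ℝ≥0∞) : Prop where
  convex : ConvexOnE Φ
  lsc : LowerSemicontinuous Φ
  finite_near_zero : ∃ ε : ℝ, 0 < ε ∧ ∀ x : Euc n, ‖x‖ < ε → Φ x ≠ ⊤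
  map_zero : Φ 0 = 0
  coercive : Tendsto Φ (Bornology.cobounded (Euc n)) (𝓝 ⊤)

/-- A convex body: a compact convex set. -/
def IsConvexBody {n : ℕ} (K : Set (Euc n)) : Prop :=
  IsCompact K ∧ Convex ℝ K

/-- The Young conjugate (Legendre transform) `Φ_•(ξ) = sup_η (⟨ξ,η⟩ - Φ(η))`,
`ℝ≥0∞`-valued (the supremum is nonnegative whenever `Φ 0 = 0`). -/
def yconj {n : ℕ} (Φ : Euc n → ℝ≥0∞) (ξ : Euc n) : ℝ≥0∞ :=
  ⨆ η : Euc n, ENNReal.ofReal ⟪ξ, η⟫ - Φ η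

/-- The subgradient of an `ℝ≥0∞`-valued function. -/
def subgrad {n : ℕ} (Ψ : Euc n → ℝ≥0∞) (ξ : Euc n) : Set (Euc n) :=
  {ζ | ∀ η : Euc n, (Ψ ξ : EReal) + ((⟪ζ, η - ξ⟫ : ℝ) : EReal) ≤ (Ψ η : EReal)}

/-- The support function of a set, real-valued. -/
def suppFnR {n : ℕ} (C : Set (Euc n)) (ξ : Euc n) : ℝ :=
  sSup ((fun η => ⟪ξ, η⟫) '' C)

/-- The support function of a set, `EReal`-valued. -/
def suppFnE {n : ℕ} (C : Set (Euc n)) (ξ : Euc n) : EReal :=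
  ⨆ η ∈ C, ((⟪ξ, η⟫ : ℝ) : EReal)

/-- The polar body `L° = {x : ⟨x,y⟩ ≤ 1 ∀ y ∈ L}`. -/
def polarBody {n : ℕ} (L : Set (Euc n)) : Set (Euc n) :=
  {x | ∀ y ∈ L, ⟪x, y⟫ ≤ 1}

/-- `E^K`: the dilate `cK` of `K` with `|cK| = |E|`. -/
def setSymm {n : ℕ} (K E : Set (Euc n)) : Set (Euc n) :=
  (((volume E).toReal / (volume K).toReal) ^ ((1 : ℝ) / n)) • K

/-- The distribution function `μ(t) = |{u > t}|`. -/
def distFn {n : ℕ} (u : Euc n → ℝ) (t : ℝ) : ℝ≥0∞ := volume {x | t < u x}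

/-- The decreasing rearrangement `u*(s) = inf {t : μ(t) ≤ s}`. -/
def decRearr {n : ℕ} (u : Euc n → ℝ) (s : ℝ) : ℝ :=
  sInf {t : ℝ | distFn u t ≤ ENNReal.ofReal s}

/-- The symmetral `u^K(x) = u*(|K| H₀^K(x)ⁿ)` of `u` with respect to `K`. -/
def funcSymm {n : ℕ} (K : Set (Euc n)) (u : Euc n → ℝ) (x : Euc n) : ℝ :=
  decRearr u ((volume K).toReal * gauge K x ^ n)

/-- The symmetral `Ψ_K` of an `n`-dimensional Young function `Ψ` with respect to `K`,
characterized by `{Ψ_K ≤ t} = −({Ψ ≤ t}^K)`; equivalently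
`Ψ_K(ξ) = inf {t : |K| H₀^K(−ξ)ⁿ ≤ |{Ψ ≤ t}|}`. -/
def youngSymm {n : ℕ} (K : Set (Euc n)) (Ψ : Euc n → ℝ≥0∞) (ξ : Euc n) : ℝ≥0∞ :=
  sInf {t : ℝ≥0∞ | volume K * ENNReal.ofReal (gauge K (-ξ) ^ n) ≤ volume {η | Ψ η ≤ t}}

/-- The essential infimum of a real function on `ℝⁿ`, valued in `EReal`. -/
def eInf {n : ℕ} (u : Euc n → ℝ) : EReal := essInf (fun x => (u x : EReal)) volume

/-- The essential supremum of a real function on `ℝⁿ`, valued in `EReal`. -/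
def eSup {n : ℕ} (u : Euc n → ℝ) : EReal := essSup (fun x => (u x : EReal)) volume

/-- `u ∈ M_d(ℝⁿ)`: measurable with `|{u > t}| < ∞` for all `t > ess inf u`. -/
def MemMd {n : ℕ} (u : Euc n → ℝ) : Prop :=
  Measurable u ∧ ∀ t : ℝ, eInf u < (t : EReal) → distFn u t < ⊤

/-- `g` is the weak gradient of `u ∈ W^{1,1}_loc(ℝⁿ)`. -/
def HasWeakGradient {n : ℕ} (u : Euc n → ℝ) (g : Euc n → Euc n) : Prop :=
  LocallyIntegrable u volume ∧ LocallyIntegrable g volume ∧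
    ∀ φ : Euc n → ℝ, ContDiff ℝ (⊤ : ℕ∞) φ → HasCompactSupport φ →
      ∀ v : Euc n, ∫ x, u x * fderiv ℝ φ x v = - ∫ x, ⟪g x, v⟫ * φ x

/-- `u ∈ V^{1,Φ}_d(ℝⁿ)`, with weak gradient `g` and `∫ Φ(∇u) < ∞`. -/
def MemV1d {n : ℕ} (Φ : Euc n → ℝ≥0∞) (u : Euc n → ℝ) (g : Euc n → Euc n) : Prop :=
  HasWeakGradient u g ∧ MemMd u ∧ ∫⁻ x, Φ (g x) < ⊤

/-- A one-dimensional Young function (on `[0,∞)`, extended arbitrarily to `ℝ`). -/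
structure IsYoung1 (A : ℝ → ℝ≥0∞) : Prop where
  map_zero : A 0 = 0
  convex : ∀ x y : ℝ, 0 ≤ x → 0 ≤ y → ∀ a b : ℝ, 0 ≤ a → 0 ≤ b → a + b = 1 →
    A (a * x + b * y) ≤ ENNReal.ofReal a * A x + ENNReal.ofReal b * A y
  left_cont : ∀ t : ℝ, 0 < t → Tendsto A (𝓝[<] t) (𝓝 (A t))
  nonconst : ∃ s t : ℝ, 0 < s ∧ 0 < t ∧ A s ≠ A t

/-- The Young conjugate of a one-dimensional Young function. -/
def yconj1 (A : ℝ → ℝ≥0∞) (t : ℝ) : ℝ≥0∞ :=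
  ⨆ (s : ℝ) (_ : 0 ≤ s), ENNReal.ofReal (s * t) - A s

/-- The generalized (right-continuous) inverse of a one-dimensional Young function. -/
def rinv (A : ℝ → ℝ≥0∞) (s : ℝ≥0∞) : ℝ :=
  sSup {t : ℝ | 0 ≤ t ∧ A t ≤ s}

/-- The one-dimensional Brunn–Minkowski inequality for nonempty compact sets. -/
theorem volume_add_le_volume_add_of_isCompact {A B : Set ℝ} (hA : IsCompact A) (hB : IsCompact B)
    (hA' : A.Nonempty) (hB' : B.Nonempty) :
    volume A + volume B ≤ volume (A + B) := by
  set p := sSup A with hp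
  set q := sInf B with hq
  have hpA : p ∈ A := hA.sSup_mem hA'
  have hqB : q ∈ B := hB.sInf_mem hB'
  have h1 : volume ((fun x => q + x) '' A) = volume A := by simp
  have h2 : volume ((fun x => p + x) '' B) = volume B := by simp
  have hsub : (fun x => q + x) '' A ∪ (fun x => p + x) '' B ⊆ A + B := by
    rintro _ (⟨x, hx, rfl⟩ | ⟨x, hx, rfl⟩)
    · exact ⟨x, hx, q, hqB, add_comm _ _⟩
    · exact ⟨p, hpA, x, hx, rfl⟩
  have hdisj : AEDisjoint volume ((fun x => q + x) '' A) ((fun x => p + x) '' B) := by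
    refine measure_mono_null (t := {p + q}) ?_ (by simp)
    rintro _ ⟨⟨x, hx, rfl⟩, ⟨y, hy, hxy⟩⟩
    have hxp : x ≤ p := le_csSup hA.bddAbove hx
    have hyq : q ≤ y := csInf_le hB.bddBelow hy
    simp only [mem_singleton_iff] at hxy ⊢
    linarith
  rw [← h1, ← h2, ← measure_union₀ _ hdisj]
  · exact measure_mono hsub
  · exact (hB.image (by fun_prop)).measurableSet.nullMeasurableSet

/-- The one-dimensional Brunn–Minkowski inequality for nonempty measurable sets. -/
theorem volume_add_le_of_add_subset {A B C : Set ℝ} (hA : MeasurableSet A) (hB : MeasurableSet B)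
    (hA' : A.Nonempty) (hB' : B.Nonempty) (hC : A + B ⊆ C) :
    volume A + volume B ≤ volume C := by
  have key : ∀ A₀ ⊆ A, ∀ B₀ ⊆ B, IsCompact A₀ → IsCompact B₀ →
      volume A₀ + volume B₀ ≤ volume C := by
    intro A₀ hA₀ B₀ hB₀ hAc hBc
    obtain ⟨x, hx⟩ := hA'
    obtain ⟨y, hy⟩ := hB'
    refine (add_le_add (measure_mono (subset_insert x A₀)) (measure_mono (subset_insert y B₀))).trans
      ((volume_add_le_volume_add_of_isCompact (hAc.insert x) (hBc.insert y)
        (insert_nonempty _ _) (insert_nonempty _ _)).trans (measure_mono (Subset.trans ?_ hC)))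
    exact add_subset_add (insert_subset hx hA₀) (insert_subset hy hB₀)
  have inner : ∀ S : Set ℝ, MeasurableSet S →
      volume S = ⨆ K : {K // K ⊆ S ∧ IsCompact K}, volume K.1 := by
    intro S hS
    rw [hS.measure_eq_iSup_isCompact, iSup_subtype]
    simp only [iSup_and]
  have : Nonempty {K // K ⊆ A ∧ IsCompact K} := ⟨⟨∅, empty_subset _, isCompact_empty⟩⟩
  have : Nonempty {K // K ⊆ B ∧ IsCompact K} := ⟨⟨∅, empty_subset _, isCompact_empty⟩⟩
  rw [inner A hA, inner B hB]
  exact ENNReal.iSup_add_iSup_le fun K L => key _ K.2.1 _ L.2.1 K.2.2 L.2.2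

theorem ENNReal.geom_mean_le_arith_mean2_weighted {a b : ℝ} (ha : 0 < a) (hb : 0 < b)
    (hab : a + b = 1) (x y : ℝ≥0∞) :
    x ^ a * y ^ b ≤ ENNReal.ofReal a * x + ENNReal.ofReal b * y := by
  have hpq : (a⁻¹).HolderConjugate b⁻¹ := by
    rw [Real.holderConjugate_iff]
    refine ⟨?_, by simpa using hab⟩
    rw [one_lt_inv₀ ha]; linarith
  have := ENNReal.young_inequality (x ^ a) (y ^ b) hpq
  rwa [← ENNReal.rpow_mul, ← ENNReal.rpow_mul, mul_inv_cancel₀ ha.ne', mul_inv_cancel₀ hb.ne',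
    ENNReal.rpow_one, ENNReal.rpow_one, ENNReal.ofReal_inv_of_pos ha, ENNReal.ofReal_inv_of_pos hb,
    ENNReal.div_eq_inv_mul, ENNReal.div_eq_inv_mul, inv_inv, inv_inv] at this

/-- The Prékopa–Leindler inequality for functions on the line with supremum one, in its additive
form. -/
theorem lintegral_add_le_of_superlevel {a b : ℝ} (ha : 0 < a) (hb : 0 < b)
    {f g h : ℝ → ℝ≥0∞} (hf : Measurable f) (hg : Measurable g) (hh : Measurable h)
    (hf1 : ⨆ x, f x = 1) (hg1 : ⨆ x, g x = 1)
    (hfgh : ∀ x y t, t < f x → t < g y → t < h (a * x + b * y)) :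
    ENNReal.ofReal a * (∫⁻ x, f x) + ENNReal.ofReal b * (∫⁻ x, g x) ≤ ∫⁻ x, h x := by
  have layer : ∀ u : ℝ → ℝ≥0∞, Measurable u → (∀ x, u x ≤ 1) →
      ∫⁻ x, u x = ∫⁻ t in Ioo (0 : ℝ) 1, volume {x | ENNReal.ofReal t < u x} := by
    intro u hu hu1
    have hfin : ∀ x, u x ≠ ⊤ := fun x => ((hu1 x).trans_lt ENNReal.one_lt_top).ne
    have h1 := lintegral_eq_lintegral_meas_lt (volume : Measure ℝ) (f := fun x => (u x).toReal)
      (ae_of_all _ fun _ => ENNReal.toReal_nonneg) hu.ennreal_toReal.aemeasurable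
    simp only [ENNReal.ofReal_toReal (hfin _)] at h1
    rw [h1, ← lintegral_indicator measurableSet_Ioi, ← lintegral_indicator measurableSet_Ioo]
    congr 1
    ext t
    by_cases ht : 0 < t
    · have hset : {x | t < (u x).toReal} = {x | ENNReal.ofReal t < u x} := by
        ext x
        exact (ENNReal.ofReal_lt_iff_lt_toReal ht.le (hfin x)).symm
      by_cases ht1 : t < 1
      · simp [indicator, ht, ht1, hset]
      · have : {x | ENNReal.ofReal t < u x} = ∅ := by
          ext x
          simp only [mem_ofPred_eq, mem_empty_iff_false, iff_false, not_lt]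
          exact (hu1 x).trans (by simpa using not_lt.1 ht1)
        simp [indicator, ht, ht1, hset, this]
    · simp [indicator, ht]
  have hle : ∀ u : ℝ → ℝ≥0∞, ⨆ x, u x = 1 → ∀ x, u x ≤ 1 := fun u hu x => hu ▸ le_iSup u x
  calc ENNReal.ofReal a * (∫⁻ x, f x) + ENNReal.ofReal b * (∫⁻ x, g x)
      ≤ ∫⁻ x, min (h x) 1 := by
        rw [layer f hf (hle f hf1), layer g hg (hle g hg1),
          layer (fun x => min (h x) 1) (hh.min measurable_const) (fun x => min_le_right _ _)]
        rw [← lintegral_const_mul' _ _ ENNReal.ofReal_ne_top,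
          ← lintegral_const_mul' _ _ ENNReal.ofReal_ne_top]
        refine (le_lintegral_add _ _).trans (setLIntegral_mono' measurableSet_Ioo ?_)
        rintro t ⟨-, ht1⟩
        have ht1' : ENNReal.ofReal t < 1 := by simpa using ht1
        have e : ∀ {c : ℝ}, 0 < c → ∀ S : Set ℝ,
            ENNReal.ofReal c * volume S = volume (c • S) := by
          intro c hc S
          simp [Measure.addHaar_smul, abs_of_pos hc]
        rw [e ha, e hb]
        refine volume_add_le_of_add_subset ?_ ?_ ?_ ?_ ?_
        · exact (measurableSet_lt measurable_const hf).const_smul₀ a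
        · exact (measurableSet_lt measurable_const hg).const_smul₀ b
        · exact Set.Nonempty.smul_set
            (lt_iSup_iff.1 (hf1.symm ▸ ht1' : ENNReal.ofReal t < ⨆ x, f x))
        · exact Set.Nonempty.smul_set
            (lt_iSup_iff.1 (hg1.symm ▸ ht1' : ENNReal.ofReal t < ⨆ x, g x))
        · rintro _ ⟨_, ⟨x, hx, rfl⟩, _, ⟨y, hy, rfl⟩, rfl⟩
          exact lt_min (hfgh x y _ hx hy) ht1'
    _ ≤ ∫⁻ x, h x := lintegral_mono fun x => min_le_left _ _

/-- The Prékopa–Leindler inequality for functions on the line with supremum one. -/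
theorem lintegral_rpow_mul_le_of_iSup_eq_one {a b : ℝ} (ha : 0 < a) (hb : 0 < b)
    (hab : a + b = 1) {f g h : ℝ → ℝ≥0∞} (hf : Measurable f) (hg : Measurable g)
    (hh : Measurable h) (hf1 : ⨆ x, f x = 1) (hg1 : ⨆ x, g x = 1)
    (hfgh : ∀ x y, f x ^ a * g y ^ b ≤ h (a * x + b * y)) :
    (∫⁻ x, f x) ^ a * (∫⁻ x, g x) ^ b ≤ ∫⁻ x, h x := by
  refine (ENNReal.geom_mean_le_arith_mean2_weighted ha hb hab _ _).trans
    (lintegral_add_le_of_superlevel ha hb hf hg hh hf1 hg1 fun x y t hx hy => ?_)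
  refine lt_of_lt_of_le ?_ (hfgh x y)
  calc t = t ^ a * t ^ b := by
        rw [← ENNReal.rpow_add_of_nonneg _ _ ha.le hb.le, hab, ENNReal.rpow_one]
    _ < f x ^ a * g y ^ b :=
        ENNReal.mul_lt_mul (ENNReal.rpow_lt_rpow hx ha) (ENNReal.rpow_lt_rpow hy hb)

/-- The Prékopa–Leindler inequality for bounded functions on the line. -/
theorem lintegral_rpow_mul_le_of_iSup_ne_top {a b : ℝ} (ha : 0 < a) (hb : 0 < b)
    (hab : a + b = 1) {f g h : ℝ → ℝ≥0∞} (hf : Measurable f) (hg : Measurable g)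
    (hh : Measurable h) (hf1 : ⨆ x, f x ≠ ⊤) (hg1 : ⨆ x, g x ≠ ⊤)
    (hfgh : ∀ x y, f x ^ a * g y ^ b ≤ h (a * x + b * y)) :
    (∫⁻ x, f x) ^ a * (∫⁻ x, g x) ^ b ≤ ∫⁻ x, h x := by
  set F := ⨆ x, f x with hF
  set G := ⨆ x, g x with hG
  by_cases hF0 : F = 0
  · have : ∀ x, f x = 0 := fun x => le_antisymm (hF0 ▸ le_iSup f x) zero_le
    simp [this, ha]
  by_cases hG0 : G = 0
  · have : ∀ x, g x = 0 := fun x => le_antisymm (hG0 ▸ le_iSup g x) zero_le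
    simp [this, hb]
  have hFa : F ^ a ≠ 0 := by simp [hF0, ha.le, ha]
  have hFa' : F ^ a ≠ ⊤ := ENNReal.rpow_ne_top_of_nonneg ha.le hf1
  have hGb : G ^ b ≠ 0 := by simp [hG0, hb.le, hb]
  have hGb' : G ^ b ≠ ⊤ := ENNReal.rpow_ne_top_of_nonneg hb.le hg1
  have key := lintegral_rpow_mul_le_of_iSup_eq_one ha hb hab (f := fun x => F⁻¹ * f x)
    (g := fun x => G⁻¹ * g x) (h := fun x => ((F ^ a)⁻¹ * (G ^ b)⁻¹) * h x)
    (hf.const_mul _) (hg.const_mul _) (hh.const_mul _)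
    (by rw [← ENNReal.mul_iSup, ← hF, ENNReal.inv_mul_cancel hF0 hf1])
    (by rw [← ENNReal.mul_iSup, ← hG, ENNReal.inv_mul_cancel hG0 hg1])
    (fun x y => by
      rw [ENNReal.mul_rpow_of_nonneg _ _ ha.le, ENNReal.mul_rpow_of_nonneg _ _ hb.le,
        ENNReal.inv_rpow, ENNReal.inv_rpow, mul_mul_mul_comm]
      gcongr
      exact hfgh x y)
  rw [lintegral_const_mul _ hf, lintegral_const_mul _ hg, lintegral_const_mul _ hh,
    ENNReal.mul_rpow_of_nonneg _ _ ha.le, ENNReal.mul_rpow_of_nonneg _ _ hb.le,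
    ENNReal.inv_rpow, ENNReal.inv_rpow, mul_mul_mul_comm] at key
  refine (ENNReal.mul_le_mul_iff_right (a := (F ^ a)⁻¹ * (G ^ b)⁻¹) ?_ ?_).1 key
  · simp [hFa', hGb']
  · exact ENNReal.mul_ne_top (by simpa using hFa) (by simpa using hGb)

/-- The Prékopa–Leindler inequality holds on the measure space `X`. -/
def PrekopaLeindler (X : Type*) [AddCommGroup X] [Module ℝ X] [MeasureSpace X] : Prop :=
  ∀ a b : ℝ, 0 < a → 0 < b → a + b = 1 → ∀ f g h : X → ℝ≥0∞,
    Measurable f → Measurable g → Measurable h →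
    (∀ x y, f x ^ a * g y ^ b ≤ h (a • x + b • y)) →
    (∫⁻ x, f x) ^ a * (∫⁻ x, g x) ^ b ≤ ∫⁻ x, h x

theorem prekopaLeindler_real : PrekopaLeindler ℝ := by
  intro a b ha hb hab f g h hf hg hh hfgh
  have trunc : ∀ u : ℝ → ℝ≥0∞, Measurable u → ∀ c : ℝ, 0 < c →
      (∫⁻ x, u x) ^ c = ⨆ k : ℕ, (∫⁻ x, min (u x) k) ^ c := by
    intro u hu c hc
    have h1 : ∫⁻ x, u x = ⨆ k : ℕ, ∫⁻ x, min (u x) k := by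
      rw [← lintegral_iSup (fun k => hu.min measurable_const)]
      · congr 1
        ext x
        rw [← inf_iSup_eq, ENNReal.iSup_natCast, inf_top_eq]
      · intro k l hkl x
        exact min_le_min_left _ (by exact_mod_cast hkl)
    rw [h1]
    exact (ENNReal.orderIsoRpow c hc).map_iSup _
  rw [trunc f hf a ha, trunc g hg b hb]
  simp only [ENNReal.iSup_mul, ENNReal.mul_iSup]
  have bdd : ∀ (u : ℝ → ℝ≥0∞) (k : ℕ), ⨆ x, min (u x) k ≠ ⊤ := fun u k =>
    ((iSup_le fun x => min_le_right _ _).trans_lt (ENNReal.natCast_lt_top k)).ne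
  refine iSup_le fun k => iSup_le fun l => ?_
  refine lintegral_rpow_mul_le_of_iSup_ne_top ha hb hab (hf.min measurable_const)
    (hg.min measurable_const) hh (bdd f _) (bdd g _) fun x y => ?_
  refine le_trans ?_ (hfgh x y)
  gcongr <;> exact min_le_left _ _

theorem PrekopaLeindler.prod {X Y : Type*} [AddCommGroup X] [Module ℝ X] [MeasureSpace X]
    [AddCommGroup Y] [Module ℝ Y] [MeasureSpace Y] [SFinite (volume : Measure Y)]
    (hX : PrekopaLeindler X) (hY : PrekopaLeindler Y) : PrekopaLeindler (X × Y) := by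
  intro a b ha hb hab f g h hf hg hh hfgh
  rw [Measure.volume_eq_prod, lintegral_prod _ hf.aemeasurable, lintegral_prod _ hg.aemeasurable,
    lintegral_prod _ hh.aemeasurable]
  refine hX a b ha hb hab _ _ _ hf.lintegral_prod_right' hg.lintegral_prod_right'
    hh.lintegral_prod_right' fun x x' => ?_
  exact hY a b ha hb hab _ _ _ (hf.comp measurable_prodMk_left) (hg.comp measurable_prodMk_left)
    (hh.comp measurable_prodMk_left) fun y y' => hfgh (x, y) (x', y')

theorem PrekopaLeindler.of_measurePreserving {X Y : Type*} [AddCommGroup X] [Module ℝ X]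
    [MeasureSpace X] [AddCommGroup Y] [Module ℝ Y] [MeasureSpace Y] (hX : PrekopaLeindler X)
    (L : X →ₗ[ℝ] Y) (hL : MeasurePreserving L) : PrekopaLeindler Y := by
  intro a b ha hb hab f g h hf hg hh hfgh
  rw [← hL.lintegral_comp hf, ← hL.lintegral_comp hg, ← hL.lintegral_comp hh]
  refine hX a b ha hb hab _ _ _ (hf.comp hL.measurable) (hg.comp hL.measurable)
    (hh.comp hL.measurable) fun x y => ?_
  simpa using hfgh (L x) (L y)

theorem prekopaLeindler_pi : ∀ n : ℕ, PrekopaLeindler (Fin n → ℝ)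
  | 0 => by
    intro a b ha hb hab f g h hf hg hh hfgh
    simp only [lintegral_unique, volume_pi, Measure.pi_empty_univ, mul_one]
    have := hfgh default default
    convert! this using 4
  | n + 1 => by
    refine PrekopaLeindler.of_measurePreserving (prekopaLeindler_real.prod (prekopaLeindler_pi n))
      (Fin.consLinearEquiv ℝ (fun _ : Fin (n + 1) => ℝ)).toLinearMap ?_
    have := (volume_preserving_piFinSuccAbove (fun _ : Fin (n + 1) => ℝ) 0).symm
    convert! this using 1
    ext p : 1
    exact (Fin.insertNth_zero' p.1 p.2).symm

theorem prekopaLeindler_euclideanSpace (n : ℕ) : PrekopaLeindler (EuclideanSpace ℝ (Fin n)) :=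
  (prekopaLeindler_pi n).of_measurePreserving
    (WithLp.linearEquiv 2 ℝ (Fin n → ℝ)).symm.toLinearMap (PiLp.volume_preserving_toLp (Fin n))

/-- The Prékopa–Leindler inequality for sets: the multiplicative Brunn–Minkowski inequality. -/
theorem PrekopaLeindler.volume_rpow_mul_le {X : Type*} [AddCommGroup X] [Module ℝ X]
    [MeasureSpace X] (hX : PrekopaLeindler X) {a b : ℝ} (ha : 0 < a) (hb : 0 < b)
    (hab : a + b = 1) {A B C : Set X} (hA : MeasurableSet A) (hB : MeasurableSet B)
    (hC : MeasurableSet C) (hABC : ∀ x ∈ A, ∀ y ∈ B, a • x + b • y ∈ C) :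
    volume A ^ a * volume B ^ b ≤ volume C := by
  have := hX a b ha hb hab (A.indicator 1) (B.indicator 1) (C.indicator 1)
    (measurable_one.indicator hA) (measurable_one.indicator hB) (measurable_one.indicator hC)
    (fun x y => by
      by_cases hx : x ∈ A
      · by_cases hy : y ∈ B
        · simp [hx, hy, hABC x hx y hy]
        · simp [hy, hb]
      · simp [hx, ha])
  simpa [lintegral_indicator_one, hA, hB, hC] using this

/-- The Brunn–Minkowski inequality for nonempty measurable sets of finite measure. -/
theorem brunn_minkowski {n : ℕ} (hn : n ≠ 0) {a b : ℝ} (ha : 0 ≤ a) (hb : 0 ≤ b)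
    {A B C : Set (EuclideanSpace ℝ (Fin n))} (hA : MeasurableSet A) (hB : MeasurableSet B)
    (hC : MeasurableSet C) (hA' : A.Nonempty) (hB' : B.Nonempty)
    (hAf : volume A ≠ ⊤) (hBf : volume B ≠ ⊤) (hCf : volume C ≠ ⊤)
    (hABC : ∀ x ∈ A, ∀ y ∈ B, a • x + b • y ∈ C) :
    a * volume.real A ^ (1 / n : ℝ) + b * volume.real B ^ (1 / n : ℝ) ≤
      volume.real C ^ (1 / n : ℝ) := by
  have hn' : (n : ℝ) ≠ 0 := by exact_mod_cast hn
  have hroot : ∀ {t x : ℝ}, 0 ≤ t → 0 ≤ x →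
      (t ^ n * x) ^ (1 / n : ℝ) = t * x ^ (1 / n : ℝ) := by
    intro t x ht hx
    rw [Real.mul_rpow (by positivity) hx, one_div, Real.pow_rpow_inv_natCast ht hn]
  have hsmul : ∀ {t : ℝ}, 0 ≤ t → ∀ S : Set (EuclideanSpace ℝ (Fin n)),
      volume.real (t • S) = t ^ n * volume.real S := by
    intro t ht S
    simp [Measure.real, Measure.addHaar_smul, abs_of_nonneg ht, ht]
  have degenerate : ∀ {t : ℝ}, 0 ≤ t → ∀ S : Set (EuclideanSpace ℝ (Fin n)), ∀ z,
      (∀ x ∈ S, z + t • x ∈ C) →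
      t * volume.real S ^ (1 / n : ℝ) ≤ volume.real C ^ (1 / n : ℝ) := by
    intro t ht S z hz
    rw [← hroot ht measureReal_nonneg, ← hsmul ht]
    have h1 : volume.real (t • S) = volume.real ((fun x => z + x) '' (t • S)) := by
      simp [Measure.real]
    rw [h1]
    refine Real.rpow_le_rpow measureReal_nonneg (measureReal_mono ?_ hCf) (by positivity)
    rintro _ ⟨_, ⟨x, hx, rfl⟩, rfl⟩
    exact hz x hx
  set α := volume.real A ^ (1 / n : ℝ) with hα
  set β := volume.real B ^ (1 / n : ℝ) with hβ
  have hα0 : 0 ≤ α := by positivity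
  have hβ0 : 0 ≤ β := by positivity
  obtain h0 | hpa := (mul_nonneg ha hα0).eq_or_lt
  · obtain ⟨x, hx⟩ := hA'
    rw [← h0, zero_add]
    exact degenerate hb B (a • x) fun y hy => hABC x hx y hy
  obtain h0 | hpb := (mul_nonneg hb hβ0).eq_or_lt
  · obtain ⟨y, hy⟩ := hB'
    rw [← h0, add_zero]
    exact degenerate ha A (b • y) fun x hx => by rw [add_comm]; exact hABC x hx y hy
  have hα1 : 0 < α := pos_of_mul_pos_right hpa ha
  have hβ1 : 0 < β := pos_of_mul_pos_right hpb hb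
  set m := a * α + b * β with hm
  have hm0 : 0 < m := by positivity
  have unit : ∀ S : Set (EuclideanSpace ℝ (Fin n)), volume S ≠ ⊤ →
      0 < volume.real S ^ (1 / n : ℝ) →
      volume ((volume.real S ^ (1 / n : ℝ))⁻¹ • S) = 1 := by
    intro S hS hpos
    have h1 : volume.real ((volume.real S ^ (1 / n : ℝ))⁻¹ • S) = 1 := by
      rw [hsmul (by positivity), inv_pow, one_div,
        Real.rpow_inv_natCast_pow measureReal_nonneg hn, inv_mul_cancel₀]
      rintro h
      simp [h, hn] at hpos
    rwa [Measure.real, ENNReal.toReal_eq_one_iff] at h1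
  have key := (prekopaLeindler_euclideanSpace n).volume_rpow_mul_le
    (a := a * α / m) (b := b * β / m) (by positivity) (by positivity)
    (by rw [← add_div, div_self hm0.ne'])
    (hA.const_smul₀ α⁻¹) (hB.const_smul₀ β⁻¹) (hC.const_smul₀ m⁻¹)
    (by
      rintro _ ⟨x, hx, rfl⟩ _ ⟨y, hy, rfl⟩
      refine ⟨_, hABC x hx y hy, ?_⟩
      simp only [smul_add, smul_smul]
      congr 2 <;> field_simp)
  rw [unit A hAf hα1, unit B hBf hβ1, ENNReal.one_rpow, ENNReal.one_rpow, mul_one] at key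
  have h2 : 1 ≤ volume.real (m⁻¹ • C) := by
    have hfin : volume (m⁻¹ • C) ≠ ⊤ := by
      rw [Measure.addHaar_smul]
      exact ENNReal.mul_ne_top ENNReal.ofReal_ne_top hCf
    exact ENNReal.toReal_one ▸ ENNReal.toReal_mono hfin key
  rw [hsmul (by positivity), inv_pow, ← div_eq_inv_mul, one_le_div (by positivity)] at h2
  calc m = (m ^ n) ^ (1 / n : ℝ) := by
        rw [one_div, Real.pow_rpow_inv_natCast hm0.le hn]
    _ ≤ _ := by gcongr

theorem yconj_le_iff {n : ℕ} {Φ : Euc n → ℝ≥0∞} {ξ : Euc n} {t : ℝ≥0∞} :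
    yconj Φ ξ ≤ t ↔ ∀ η : Euc n, ENNReal.ofReal ⟪ξ, η⟫ ≤ t + Φ η := by
  simp only [yconj, iSup_le_iff, tsub_le_iff_right]

theorem isClosed_yconj_le {n : ℕ} (Φ : Euc n → ℝ≥0∞) (t : ℝ≥0∞) :
    IsClosed {ξ | yconj Φ ξ ≤ t} := by
  have : {ξ | yconj Φ ξ ≤ t} = ⋂ η : Euc n, {ξ : Euc n | ENNReal.ofReal ⟪ξ, η⟫ ≤ t + Φ η} := by
    ext ξ
    simp [yconj_le_iff]
  rw [this]
  refine isClosed_iInter fun η => isClosed_le ?_ continuous_const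
  exact ENNReal.continuous_ofReal.comp (by fun_prop)

theorem yconj_add_le {n : ℕ} {Φ : Euc n → ℝ≥0∞} {ξ ζ : Euc n} {a b s t : ℝ}
    (ha : 0 ≤ a) (hb : 0 ≤ b) (hab : a + b = 1) (hs : 0 ≤ s) (ht : 0 ≤ t)
    (hξ : yconj Φ ξ ≤ ENNReal.ofReal s) (hζ : yconj Φ ζ ≤ ENNReal.ofReal t) :
    yconj Φ (a • ξ + b • ζ) ≤ ENNReal.ofReal (a * s + b * t) := by
  rw [yconj_le_iff] at hξ hζ ⊢
  intro η
  calc ENNReal.ofReal ⟪a • ξ + b • ζ, η⟫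
      ≤ ENNReal.ofReal a * ENNReal.ofReal ⟪ξ, η⟫ + ENNReal.ofReal b * ENNReal.ofReal ⟪ζ, η⟫ := by
        rw [inner_add_left, real_inner_smul_left, real_inner_smul_left, ← ENNReal.ofReal_mul ha,
          ← ENNReal.ofReal_mul hb]
        exact ENNReal.ofReal_add_le
    _ ≤ ENNReal.ofReal a * (ENNReal.ofReal s + Φ η)
        + ENNReal.ofReal b * (ENNReal.ofReal t + Φ η) := by
        gcongr
        exacts [hξ η, hζ η]
    _ = ENNReal.ofReal (a * s + b * t) + Φ η := by
        rw [mul_add, mul_add, add_add_add_comm, ← add_mul, ← ENNReal.ofReal_add ha hb, hab,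
          ENNReal.ofReal_one, one_mul, ← ENNReal.ofReal_mul ha, ← ENNReal.ofReal_mul hb,
          ← ENNReal.ofReal_add (by positivity) (by positivity)]

theorem yconj_zero {n : ℕ} (Φ : Euc n → ℝ≥0∞) : yconj Φ 0 = 0 := by
  simp [yconj]

theorem IsNYoung.volume_yconj_le_ne_top {n : ℕ} {Φ : Euc n → ℝ≥0∞} (hΦ : IsNYoung Φ)
    {t : ℝ≥0∞} (ht : t ≠ ⊤) : volume {ξ | yconj Φ ξ ≤ t} ≠ ⊤ := by
  obtain ⟨ε, hε, hfin⟩ := hΦ.finite_near_zero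
  have bound : ∀ (i : Fin n) (c : ℝ), |c| < ε →
      ∃ M : ℝ, ∀ ξ : Euc n, yconj Φ ξ ≤ t → c * ξ i ≤ M := by
    intro i c hc
    refine ⟨(t + Φ (EuclideanSpace.single i c)).toReal, fun ξ hξ => ?_⟩
    have h1 := yconj_le_iff.1 hξ (EuclideanSpace.single i c)
    have h2 : Φ (EuclideanSpace.single i c) ≠ ⊤ := hfin _ (by simpa using hc)
    rw [ENNReal.ofReal_le_iff_le_toReal (ENNReal.add_ne_top.2 ⟨ht, h2⟩)] at h1
    simpa [EuclideanSpace.inner_single_right] using h1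
  have hε' : |ε / 2| < ε := by rw [abs_of_pos (by positivity)]; linarith
  choose M hM using fun i => bound i (ε / 2) hε'
  choose N hN using fun i => bound i (-(ε / 2)) (by rwa [abs_neg])
  have hsub : {ξ | yconj Φ ξ ≤ t} ⊆
      (WithLp.ofLp : Euc n → Fin n → ℝ) ⁻¹' Icc (fun i => -(N i / (ε / 2)))
        (fun i => M i / (ε / 2)) := by
    intro ξ hξ
    refine ⟨fun i => ?_, fun i => ?_⟩
    · have := hN i ξ hξ
      simp only
      rw [neg_le, le_div_iff₀ (by positivity)]
      linarith
    · have := hM i ξ hξ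
      simp only
      rw [le_div_iff₀ (by positivity)]
      linarith
  refine ((measure_mono hsub).trans_lt ?_).ne
  rw [(PiLp.volume_preserving_ofLp (Fin n)).measure_preimage measurableSet_Icc.nullMeasurableSet]
  exact isCompact_Icc.measure_lt_top

theorem IsNYoung.tendsto_volume_yconj_le {n : ℕ} {Φ : Euc n → ℝ≥0∞} (hΦ : IsNYoung Φ) (s : ℝ) :
    Tendsto (fun t : ℝ => volume {ξ | yconj Φ ξ ≤ ENNReal.ofReal t}) (𝓝[>] s)
      (𝓝 (volume {ξ | yconj Φ ξ ≤ ENNReal.ofReal s})) := by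
  have hinter : {ξ | yconj Φ ξ ≤ ENNReal.ofReal s} =
      ⋂ t > s, {ξ | yconj Φ ξ ≤ ENNReal.ofReal t} := by
    ext ξ
    simp only [mem_ofPred_eq, mem_iInter]
    refine ⟨fun h t ht => h.trans (ENNReal.ofReal_le_ofReal ht.le), fun h => ?_⟩
    have hlim : Tendsto ENNReal.ofReal (𝓝[>] s) (𝓝 (ENNReal.ofReal s)) :=
      (ENNReal.continuous_ofReal.tendsto s).mono_left nhdsWithin_le_nhds
    refine ge_of_tendsto hlim ?_
    filter_upwards [self_mem_nhdsWithin] with t ht using h t ht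
  rw [hinter]
  exact tendsto_measure_biInter_gt
    (fun t _ => (isClosed_yconj_le Φ _).measurableSet.nullMeasurableSet)
    (fun t u _ htu ξ hξ => le_trans hξ (ENNReal.ofReal_le_ofReal htu))
    ⟨s + 1, by simp, hΦ.volume_yconj_le_ne_top ENNReal.ofReal_ne_top⟩

/-- The dilation factor `c` with `{Φ_• ≤ s}^K = cK`. -/
def symmRadius {n : ℕ} (K : Set (Euc n)) (Φ : Euc n → ℝ≥0∞) (s : ℝ) : ℝ :=
  (volume.real {ξ | yconj Φ ξ ≤ ENNReal.ofReal s} / volume.real K) ^ (1 / n : ℝ)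

theorem symmRadius_nonneg {n : ℕ} (K : Set (Euc n)) (Φ : Euc n → ℝ≥0∞) (s : ℝ) :
    0 ≤ symmRadius K Φ s := by
  unfold symmRadius
  positivity

theorem IsNYoung.monotone_symmRadius {n : ℕ} (K : Set (Euc n)) {Φ : Euc n → ℝ≥0∞}
    (hΦ : IsNYoung Φ) : Monotone (symmRadius K Φ) := by
  intro s t hst
  unfold symmRadius
  refine Real.rpow_le_rpow (by positivity) ?_ (by positivity)
  refine div_le_div_of_nonneg_right (measureReal_mono ?_
    (hΦ.volume_yconj_le_ne_top ENNReal.ofReal_ne_top)) measureReal_nonneg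
  exact fun ξ hξ => le_trans hξ (ENNReal.ofReal_le_ofReal hst)

theorem IsNYoung.concaveOn_symmRadius {n : ℕ} (hn : n ≠ 0) (K : Set (Euc n))
    {Φ : Euc n → ℝ≥0∞} (hΦ : IsNYoung Φ) : ConcaveOn ℝ (Ici 0) (symmRadius K Φ) := by
  refine ⟨convex_Ici 0, fun s hs t ht a b ha hb hab => ?_⟩
  have hfin : ∀ t : ℝ, volume {ξ | yconj Φ ξ ≤ ENNReal.ofReal t} ≠ ⊤ := fun t =>
    hΦ.volume_yconj_le_ne_top ENNReal.ofReal_ne_top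
  have key := brunn_minkowski hn ha hb (isClosed_yconj_le Φ (ENNReal.ofReal s)).measurableSet
    (isClosed_yconj_le Φ (ENNReal.ofReal t)).measurableSet
    (isClosed_yconj_le Φ (ENNReal.ofReal (a * s + b * t))).measurableSet
    ⟨0, by simp [yconj_zero]⟩ ⟨0, by simp [yconj_zero]⟩ (hfin s) (hfin t) (hfin _)
    (fun ξ hξ ζ hζ => yconj_add_le ha hb hab hs ht hξ hζ)
  simp only [symmRadius, smul_eq_mul, Real.div_rpow measureReal_nonneg measureReal_nonneg]
  rw [mul_div_assoc', mul_div_assoc', ← add_div]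
  gcongr

theorem IsNYoung.continuousOn_symmRadius {n : ℕ} (hn : n ≠ 0) (K : Set (Euc n))
    {Φ : Euc n → ℝ≥0∞} (hΦ : IsNYoung Φ) : ContinuousOn (symmRadius K Φ) (Ici 0) := by
  intro s hs
  obtain rfl | hs' := (mem_Ici.1 hs).eq_or_lt
  · rw [← continuousWithinAt_Ioi_iff_Ici]
    have h1 := (ENNReal.tendsto_toReal (hΦ.volume_yconj_le_ne_top ENNReal.ofReal_ne_top)).comp
      (hΦ.tendsto_volume_yconj_le 0)
    exact (h1.div_const (volume.real K)).rpow_const (Or.inr (by positivity))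
  · have h1 := (hΦ.concaveOn_symmRadius hn K).continuousOn_interior
    rw [interior_Ici] at h1
    exact (h1.continuousAt (Ioi_mem_nhds hs')).continuousWithinAt

theorem youngSymm_yconj_le_iff {n : ℕ} (hn : n ≠ 0) {K : Set (Euc n)} (hK : volume K ≠ 0)
    (hK' : volume K ≠ ⊤) {Φ : Euc n → ℝ≥0∞} (hΦ : IsNYoung Φ) (η : Euc n) (s : ℝ) :
    youngSymm K (yconj Φ) η ≤ ENNReal.ofReal s ↔ gauge K (-η) ≤ symmRadius K Φ s := by
  have hKpos : 0 < volume.real K := ENNReal.toReal_pos hK hK'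
  have step : gauge K (-η) ≤ symmRadius K Φ s ↔
      volume K * ENNReal.ofReal (gauge K (-η) ^ n) ≤
        volume {ξ | yconj Φ ξ ≤ ENNReal.ofReal s} := by
    rw [← pow_le_pow_iff_left₀ (gauge_nonneg _) (symmRadius_nonneg K Φ s) hn, symmRadius, one_div,
      Real.rpow_inv_natCast_pow (by positivity) hn, le_div_iff₀' hKpos,
      ← ENNReal.ofReal_le_ofReal_iff measureReal_nonneg,
      ENNReal.ofReal_mul measureReal_nonneg, ofReal_measureReal hK',
      ofReal_measureReal (hΦ.volume_yconj_le_ne_top ENNReal.ofReal_ne_top)]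
  rw [step]
  refine ⟨fun h => ?_, fun h => sInf_le h⟩
  have hs : ENNReal.ofReal s = ENNReal.ofReal (max s 0) := by simp [ENNReal.ofReal_max]
  rw [hs] at h ⊢
  refine ge_of_tendsto (hΦ.tendsto_volume_yconj_le (max s 0)) ?_
  filter_upwards [self_mem_nhdsWithin] with t ht
  obtain ⟨u, hu, hut⟩ := sInf_lt_iff.1
    (h.trans_lt ((ENNReal.ofReal_lt_ofReal_iff_of_nonneg (le_max_right s 0)).2 ht))
  exact le_trans hu (measure_mono fun ξ hξ => le_trans hξ hut.le)

theorem suppFnR_gauge_le {n : ℕ} {K : Set (Euc n)} (hK : Bornology.IsBounded K)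
    (h0K : K ∈ 𝓝 0) {r : ℝ} (hr : 0 ≤ r) (ξ : Euc n) :
    suppFnR {η | gauge K (-η) ≤ r} ξ = r * suppFnR {η | gauge K (-η) ≤ 1} ξ := by
  have hset : {η : Euc n | gauge K (-η) ≤ r} = r • {η : Euc n | gauge K (-η) ≤ 1} := by
    obtain rfl | hr' := hr.eq_or_lt
    · rw [zero_smul_set ⟨0, by simp⟩]
      ext η
      have : gauge K (-η) = 0 ↔ -η = 0 :=
        gauge_eq_zero (absorbent_nhds_zero h0K) ((NormedSpace.isVonNBounded_iff ℝ).2 hK)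
      simpa [(gauge_nonneg (-η)).ge_iff_eq'] using this
    · ext η
      rw [mem_smul_set_iff_inv_smul_mem₀ hr'.ne']
      simp only [mem_ofPred_eq]
      rw [← smul_neg, gauge_smul_of_nonneg (by positivity), smul_eq_mul, ← div_eq_inv_mul,
        div_le_one hr']
  rw [suppFnR, hset, image_smul_comm _ _ _ (fun η => by simp [real_inner_smul_right]),
    Real.sSup_smul_of_nonneg hr, smul_eq_mul, suppFnR]

theorem suppFnR_nonneg {n : ℕ} {C : Set (Euc n)} (hC : (0 : Euc n) ∈ C) (ξ : Euc n) :
    0 ≤ suppFnR C ξ :=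
  Real.sSup_nonneg' ⟨0, ⟨0, hC, by simp⟩, le_rfl⟩

/-- **Lemma (properties of `s ↦ h_{{Φ_{•K} ≤ s}}(ξ)`).** -/
theorem statement12 {n : ℕ} (hn : 1 ≤ n) (K : Set (Euc n)) (hK : IsConvexBody K)
    (h0K : (0 : Euc n) ∈ interior K)
    (Φ : Euc n → ℝ≥0∞) (hΦ : IsNYoung Φ)
    (ξ : Euc n) (hξ : ξ ≠ 0) :
    (∀ s : ℝ, 0 ≤ s →
      0 ≤ suppFnR {η : Euc n | youngSymm K (yconj Φ) η ≤ ENNReal.ofReal s} ξ) ∧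
    MonotoneOn (fun s : ℝ => suppFnR {η : Euc n | youngSymm K (yconj Φ) η ≤ ENNReal.ofReal s} ξ)
      (Ici 0) ∧
    ConcaveOn ℝ (Ici 0)
      (fun s : ℝ => suppFnR {η : Euc n | youngSymm K (yconj Φ) η ≤ ENNReal.ofReal s} ξ) ∧
    ContinuousOn (fun s : ℝ => suppFnR {η : Euc n | youngSymm K (yconj Φ) η ≤ ENNReal.ofReal s} ξ)
      (Ici 0) := by
  have hn0 : n ≠ 0 := by omega
  have hK0 : K ∈ 𝓝 0 := mem_interior_iff_mem_nhds.1 h0K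
  have hsupp : (fun s : ℝ =>
      suppFnR {η : Euc n | youngSymm K (yconj Φ) η ≤ ENNReal.ofReal s} ξ) =
      fun s => suppFnR {η : Euc n | gauge K (-η) ≤ 1} ξ * symmRadius K Φ s := by
    ext s
    simp only [youngSymm_yconj_le_iff hn0 (Measure.measure_pos_of_mem_nhds volume hK0).ne'
      hK.1.measure_lt_top.ne hΦ]
    rw [suppFnR_gauge_le hK.1.isBounded hK0 (symmRadius_nonneg K Φ s), mul_comm]
  have hc : 0 ≤ suppFnR {η : Euc n | gauge K (-η) ≤ 1} ξ := suppFnR_nonneg (by simp) ξ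
  refine ⟨fun s _ => ?_, ?_, ?_, ?_⟩
  · rw [congrFun hsupp s]
    exact mul_nonneg hc (symmRadius_nonneg K Φ s)
  · rw [hsupp]
    exact ((hΦ.monotone_symmRadius K).const_mul hc).monotoneOn _
  · rw [hsupp]
    exact (hΦ.concaveOn_symmRadius hn0 K).smul hc
  · rw [hsupp]
    exact continuousOn_const.mul (hΦ.continuousOn_symmRadius hn0 K)

end
end

section
/- Let K ⊂ ℝⁿ be a convex body with 0 in its interior, let Φ be an n-dimensional Young function, and let u ∈ V^{1,1}_d(ℝⁿ). Then, for a.e. t ∈ (ess inf u, ess sup u): u^K is differentiable H^{n−1}-a.e. on {u^K = t} with ∇u^K(x) ≠ 0 for H^{n−1}-a.e. x ∈ {u^K = t}; and for every s ≥ 0 and H^{n−1}-a.e. pair x_1, x_2 ∈ {u^K = t}, one has h_{{Φ_{•K} ≤ s}}(∇u^K(x_1)) = h_{{Φ_{•K} ≤ s}}(∇u^K(x_2)). -/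
open MeasureTheory Filter Set
open scoped ENNReal NNReal Topology Pointwise symmDiff RealInnerProductSpace

noncomputable section

/-- If a measure dominates the diameters of the images of intervals under `w`, then it dominates
the Lebesgue outer measure of the image of every set. -/
theorem volume_image_le_of_ediam_image_le {w : ℝ → ℝ} {ρ : Measure ℝ} [ρ.OuterRegular]
    (h : ∀ I : Set ℝ, I.OrdConnected → Metric.ediam (w '' I) ≤ ρ I) (E : Set ℝ) :
    volume (w '' E) ≤ ρ E := by
  refine le_of_forall_gt_imp_ge_of_dense fun r hr => ?_
  obtain ⟨U, hEU, hU, hUr⟩ := E.exists_isOpen_lt_of_lt r hr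
  refine le_trans ?_ hUr.le
  set S : Set (Set ℝ) := (fun x => connectedComponentIn U x) '' U with hS
  have hopen : ∀ I ∈ S, IsOpen I := by
    rintro _ ⟨x, -, rfl⟩
    exact hU.connectedComponentIn
  have hdisj : S.PairwiseDisjoint id := by
    rintro _ ⟨x, hx, rfl⟩ _ ⟨y, hy, rfl⟩ hne
    exact disjoint_left.2 fun z hzx hzy => hne <|
      (connectedComponentIn_eq hzx).trans (connectedComponentIn_eq hzy).symm
  have hne : ∀ I ∈ S, (id I : Set ℝ).Nonempty := by
    rintro _ ⟨x, hx, rfl⟩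
    exact ⟨x, mem_connectedComponentIn hx⟩
  have hcount : S.Countable := hdisj.countable_of_isOpen hopen hne
  have hcover : E ⊆ ⋃₀ S := fun x hx =>
    ⟨_, ⟨x, hEU hx, rfl⟩, mem_connectedComponentIn (hEU hx)⟩
  calc volume (w '' E) ≤ volume (⋃ I ∈ S, w '' I) := by
        refine measure_mono ?_
        rintro _ ⟨x, hx, rfl⟩
        obtain ⟨I, hI, hxI⟩ := hcover hx
        exact mem_biUnion hI ⟨x, hxI, rfl⟩
    _ ≤ ∑' I : S, volume (w '' (I : Set ℝ)) := measure_biUnion_le _ hcount _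
    _ ≤ ∑' I : S, ρ (I : Set ℝ) := by
        refine ENNReal.tsum_le_tsum fun I => (Real.volume_le_diam _).trans (h _ ?_)
        obtain ⟨_, x, hx, rfl⟩ := I
        exact isPreconnected_connectedComponentIn.ordConnected
    _ = ρ (⋃₀ S) := (measure_sUnion hcount hdisj fun I hI => (hopen I hI).measurableSet).symm
    _ ≤ ρ U := by
        refine measure_mono (sUnion_subset ?_)
        rintro _ ⟨x, hx, rfl⟩
        exact connectedComponentIn_subset U x

/-- A primitive of an integrable function maps Lebesgue null sets to Lebesgue null sets. -/
theorem volume_image_primitive_eq_zero {k : ℝ → ℝ} (hk : Integrable k) (c : ℝ) {E : Set ℝ}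
    (hE : volume E = 0) : volume ((fun s => c + ∫ τ in (0 : ℝ)..s, k τ) '' E) = 0 := by
  set ρ : Measure ℝ := volume.withDensity fun τ => ‖k τ‖ₑ with hρ
  have : IsFiniteMeasure ρ := isFiniteMeasure_withDensity hk.2.ne
  refine le_antisymm ((volume_image_le_of_ediam_image_le (ρ := ρ) ?_ E).trans ?_) zero_le
  · intro I hI
    refine Metric.ediam_le ?_
    rintro _ ⟨a, ha, rfl⟩ _ ⟨b, hb, rfl⟩
    simp only [edist_add_left]
    rw [edist_comm, edist_eq_enorm_sub, intervalIntegral.integral_interval_sub_left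
      hk.intervalIntegrable hk.intervalIntegrable]
    calc ‖∫ τ in a..b, k τ‖ₑ ≤ ∫⁻ τ in uIoc a b, ‖k τ‖ₑ := by
          rw [← ofReal_norm, intervalIntegral.norm_intervalIntegral_eq, ofReal_norm]
          exact enorm_integral_le_lintegral_enorm _
      _ = ρ (uIoc a b) := by rw [hρ, withDensity_apply _ measurableSet_uIoc]
      _ ≤ ρ I := measure_mono (uIoc_subset_uIcc.trans (hI.uIcc_subset ha hb))
  · exact (withDensity_absolutelyContinuous _ _ hE).le

/-- The values at which the distribution function of `u` has zero derivative are almost never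
attained by `u`. -/
theorem volume_preimage_eq_zero_of_hasDerivAt_zero {n : ℕ} {u : Euc n → ℝ} (hu : Measurable u)
    {a b : ℝ} (ha : volume {x | a < u x} < ⊤) {A : Set ℝ} (hA : A ⊆ Ioo a b)
    (hderiv : ∀ t ∈ A, HasDerivAt (fun τ => (volume {x | τ < u x}).toReal) 0 t) :
    volume (u ⁻¹' A) = 0 := by
  have hmeas : ∀ τ, MeasurableSet {x | τ < u x} := fun τ => measurableSet_lt measurable_const hu
  set P : Measure (Euc n) := volume.restrict {x | a < u x} with hP
  have : IsFiniteMeasure P := ⟨by rw [hP, Measure.restrict_apply_univ]; exact ha⟩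
  have hfin : ∀ τ, a ≤ τ → volume {x | τ < u x} ≠ ⊤ := fun τ hτ =>
    ((measure_mono fun x (hx : τ < u x) => hτ.trans_lt hx).trans_lt ha).ne
  set ν : Measure ℝ := P.map u with hν
  have key : ∀ ε : ℝ≥0, 0 < ε → ν A ≤ (ε • volume : Measure ℝ) A := by
    intro ε hε
    refine (Besicovitch.vitaliFamily ν).measure_le_of_frequently_le (ε • volume : Measure ℝ)
      Measure.AbsolutelyContinuous.rfl A fun t ht => ?_
    refine (Besicovitch.tendsto_filterAt ν t).frequently (Eventually.frequently ?_)
    have hd := (hderiv t ht).isLittleO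
    have hd' := hd.def (c := (ε : ℝ) / 4) (by positivity)
    obtain ⟨δ, hδ, hball⟩ := Metric.eventually_nhds_iff.1 hd'
    have hta : a < t := (hA ht).1
    filter_upwards [Ioo_mem_nhdsGT (show (0 : ℝ) < min (δ / 2) ((t - a) / 2) from
      lt_min (by linarith) (by linarith))] with r hr
    have hr0 : 0 < r := hr.1
    have hrδ : r < δ / 2 := hr.2.trans_le (min_le_left _ _)
    have hra : r < (t - a) / 2 := hr.2.trans_le (min_le_right _ _)
    have h1 := @hball (t - 2 * r) (by rw [Real.dist_eq, abs_lt]; constructor <;> linarith)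
    have h2 := @hball (t + r) (by rw [Real.dist_eq, abs_lt]; constructor <;> linarith)
    simp only [smul_zero, sub_zero, Real.norm_eq_abs] at h1 h2
    rw [show t - 2 * r - t = -(2 * r) by ring, abs_neg, abs_of_pos (by linarith : 0 < 2 * r)] at h1
    rw [show t + r - t = r by ring, abs_of_pos hr0] at h2
    have hsub : {x | t + r < u x} ⊆ {x | t - 2 * r < u x} := fun x (hx : t + r < u x) =>
      show t - 2 * r < u x by linarith
    calc ν (Metric.closedBall t r) = P (u ⁻¹' Metric.closedBall t r) :=
          Measure.map_apply hu Metric.isClosed_closedBall.measurableSet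
      _ ≤ volume (u ⁻¹' Metric.closedBall t r) := Measure.restrict_apply_le _ _
      _ ≤ volume ({x | t - 2 * r < u x} \ {x | t + r < u x}) := by
          refine measure_mono fun x hx => ?_
          have hx' : |u x - t| ≤ r := by simpa [Real.dist_eq] using hx
          rw [abs_le] at hx'
          exact ⟨show t - 2 * r < u x by linarith, fun h : t + r < u x => by linarith⟩
      _ = volume {x | t - 2 * r < u x} - volume {x | t + r < u x} :=
          measure_sdiff hsub (hmeas _).nullMeasurableSet (hfin _ (by linarith))
      _ = ENNReal.ofReal ((volume {x | t - 2 * r < u x}).toReal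
            - (volume {x | t + r < u x}).toReal) := by
          rw [ENNReal.ofReal_sub _ ENNReal.toReal_nonneg,
            ENNReal.ofReal_toReal (hfin _ (by linarith)),
            ENNReal.ofReal_toReal (hfin _ (by linarith))]
      _ ≤ ENNReal.ofReal (ε * (2 * r)) := by
          refine ENNReal.ofReal_le_ofReal ?_
          have := abs_le.1 h1
          have := abs_le.1 h2
          have : 0 < (ε : ℝ) * r := by positivity
          linarith
      _ = (ε • volume : Measure ℝ) (Metric.closedBall t r) := by
          rw [Measure.smul_apply, Real.volume_closedBall, ENNReal.ofReal_mul (by positivity)]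
          simp [ENNReal.smul_def]
  have hνA : ν A = 0 := by
    refine le_antisymm (ENNReal.le_of_forall_pos_le_add fun η hη _ => ?_) zero_le
    have hvol : volume A ≤ ENNReal.ofReal (b - a) :=
      (measure_mono hA).trans (Real.volume_Ioo).le
    obtain ⟨ε, hε, hεη⟩ : ∃ ε : ℝ≥0, 0 < ε ∧ ε * Real.toNNReal (b - a) ≤ η :=
      ⟨η / (Real.toNNReal (b - a) + 1), by positivity, by
        rw [div_mul_eq_mul_div, div_le_iff₀ (by positivity)]
        gcongr
        exact le_self_add⟩
    calc ν A ≤ (ε • volume : Measure ℝ) A := key ε hε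
      _ = ε * volume A := by rw [Measure.smul_apply, ENNReal.smul_def, smul_eq_mul]
      _ ≤ ε * (Real.toNNReal (b - a) : ℝ≥0) := by gcongr; exact hvol
      _ ≤ 0 + η := by rw [zero_add]; exact_mod_cast hεη
  have h1 : P (u ⁻¹' A) = 0 :=
    le_antisymm ((Measure.le_map_apply hu.aemeasurable A).trans hνA.le) zero_le
  have hsub : u ⁻¹' A ⊆ {x | a < u x} := fun x hx => (hA hx).1
  rwa [hP, Measure.restrict_eq_self _ hsub] at h1

/-- A consequence of Eilenberg's inequality: if `E` is contained in the image under a `1`-Lipschitz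
map of every slice `N ∩ {g = s}`, `s ∈ [1, 2]`, of an `H^(d+1)`-null set `N` by a Lipschitz
function `g`, then `E` is `H^d`-null. -/
theorem hausdorffMeasure_eq_zero_of_slices {X : Type*} [MetricSpace X] [MeasurableSpace X]
    [BorelSpace X] {L : ℝ≥0} {g : X → ℝ} (hg : LipschitzWith L g) {d : ℝ} (hd : 0 ≤ d)
    {N E : Set X} (hN : μH[d + 1] N = 0) (p : ℝ → X → X)
    (hp : ∀ s ∈ Icc (1 : ℝ) 2, LipschitzWith 1 (p s))
    (hE : ∀ s ∈ Icc (1 : ℝ) 2, E ⊆ p s '' (N ∩ {x | g x = s})) : μH[d] E = 0 := by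
  rw [Measure.hausdorffMeasure_apply] at hN ⊢
  simp only [ENNReal.iSup_eq_zero] at hN ⊢
  intro r hr
  have hN' := hN r hr
  refine le_antisymm (ENNReal.le_of_forall_pos_le_add fun ε hε _ => ?_) zero_le
  rw [zero_add]
  obtain ⟨ε', hε', hεε⟩ : ∃ ε' : ℝ≥0, 0 < ε' ∧ L * ε' < ε :=
    ⟨ε / (L + 1), by positivity, by
      rw [mul_div_assoc', div_lt_iff₀ (by positivity)]
      nlinarith [hε]⟩
  have hlt : (⨅ (t : ℕ → Set X) (_ : N ⊆ ⋃ n, t n) (_ : ∀ n, Metric.ediam (t n) ≤ r),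
      ∑' n, ⨆ _ : (t n).Nonempty, Metric.ediam (t n) ^ (d + 1)) < (ε' : ℝ≥0∞) := by
    rw [hN']; exact_mod_cast hε'
  simp only [iInf_lt_iff] at hlt
  obtain ⟨t, hNt, htr, ht⟩ := hlt
  set J : ℕ → Set ℝ := fun i => toMeasurable volume (g '' t i) with hJ
  have hJm : ∀ i, MeasurableSet (J i) := fun i => measurableSet_toMeasurable _ _
  have hJvol : ∀ i, volume (J i) ≤ L * Metric.ediam (t i) := fun i => by
    rw [hJ, measure_toMeasurable]
    exact (Real.volume_le_diam _).trans (hg.ediam_image_le _)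
  set F : ℕ → ℝ → ℝ≥0∞ := fun i => (J i).indicator fun _ => Metric.ediam (t i) ^ d with hF
  have hFm : ∀ i, Measurable (F i) := fun i => measurable_const.indicator (hJm i)
  have h_int : ∫⁻ s in Icc (1 : ℝ) 2, ∑' i, F i s ≤ ε := by
    calc ∫⁻ s in Icc (1 : ℝ) 2, ∑' i, F i s ≤ ∫⁻ s, ∑' i, F i s := setLIntegral_le_lintegral _ _
      _ = ∑' i, ∫⁻ s, F i s := lintegral_tsum fun i => (hFm i).aemeasurable
      _ ≤ ∑' i, L * ⨆ _ : (t i).Nonempty, Metric.ediam (t i) ^ (d + 1) := by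
          refine ENNReal.tsum_le_tsum fun i => ?_
          rw [hF, lintegral_indicator_const (hJm i)]
          rcases (t i).eq_empty_or_nonempty with hti | hti
          · have : volume (J i) = 0 := by rw [hJ, measure_toMeasurable, hti]; simp
            rw [this, mul_zero]; exact zero_le
          · simp only [hti, iSup_pos]
            calc Metric.ediam (t i) ^ d * volume (J i)
                ≤ Metric.ediam (t i) ^ d * (L * Metric.ediam (t i)) := by gcongr; exact hJvol i
              _ = L * (Metric.ediam (t i) ^ d * Metric.ediam (t i) ^ (1 : ℝ)) := by
                  rw [ENNReal.rpow_one]; ring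
              _ = L * Metric.ediam (t i) ^ (d + 1) := by
                  rw [← ENNReal.rpow_add_of_nonneg d 1 hd zero_le_one]
      _ = L * ∑' i, ⨆ _ : (t i).Nonempty, Metric.ediam (t i) ^ (d + 1) := ENNReal.tsum_mul_left
      _ ≤ L * ε' := by gcongr
      _ ≤ ε := by exact_mod_cast hεε.le
  have hex : ∃ s ∈ Icc (1 : ℝ) 2, ∑' i, F i s ≤ ε := by
    by_contra! hcon
    have hpos : volume (Icc (1 : ℝ) 2) ≠ 0 := by rw [Real.volume_Icc]; norm_num
    have := setLIntegral_strict_mono (μ := volume) (f := fun _ : ℝ => (ε : ℝ≥0∞))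
      (g := fun s => ∑' i, F i s) measurableSet_Icc hpos
      (Measurable.tsum hFm)
      (by rw [setLIntegral_const, Real.volume_Icc]; finiteness)
      (Eventually.of_forall hcon)
    rw [setLIntegral_const, Real.volume_Icc] at this
    norm_num at this
    exact (this.trans_le h_int).false
  obtain ⟨s, hs, hFs⟩ := hex
  refine le_trans ?_ hFs
  refine iInf_le_of_le (fun i => p s '' (t i ∩ {x | g x = s})) ?_
  refine iInf_le_of_le ?_ ?_
  · rw [← image_iUnion, ← iUnion_inter]
    exact (hE s hs).trans (image_mono (inter_subset_inter_left _ hNt))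
  have hdiam : ∀ i, Metric.ediam (p s '' (t i ∩ {x | g x = s})) ≤ Metric.ediam (t i) := fun i => by
    simpa using ((hp s hs).ediam_image_le (t i ∩ {x | g x = s})).trans
      (mul_le_mul_right (Metric.ediam_mono inter_subset_left) _)
  refine iInf_le_of_le (fun i => (hdiam i).trans (htr i)) ?_
  refine ENNReal.tsum_le_tsum fun i => iSup_le fun hne => ?_
  obtain ⟨_, x, ⟨hx, hgx⟩, rfl⟩ := hne
  have hsJ : s ∈ J i := subset_toMeasurable _ _ ⟨x, hx, hgx⟩
  rw [hF]
  simp only [indicator_of_mem hsJ]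
  exact ENNReal.rpow_le_rpow (hdiam i) hd

theorem differentiableAt_gauge_of_smul {E : Type*} [NormedAddCommGroup E] [NormedSpace ℝ E]
    {K : Set E} {x : E} {s : ℝ} (hs : 0 < s) (h : DifferentiableAt ℝ (gauge K) (s • x)) :
    DifferentiableAt ℝ (gauge K) x := by
  have heq : gauge K = fun y => s⁻¹ * gauge K (s • y) := by
    funext y
    rw [gauge_smul_of_nonneg hs.le, smul_eq_mul, inv_mul_cancel_left₀ hs.ne']
  rw [heq]
  exact (DifferentiableAt.comp x (g := gauge K) h (differentiableAt_id.const_smul s)).const_mul _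

/-- The gauge of a convex neighbourhood of the origin is differentiable almost everywhere on its
level sets, with respect to the Hausdorff measure of codimension one. -/
theorem hausdorffMeasure_not_differentiableAt_gauge_eq_zero {n : ℕ} (hn : 1 ≤ n)
    {K : Set (Euc n)} (hK : Convex ℝ K) (h0 : K ∈ 𝓝 0) {r : ℝ} (hr : 0 < r) :
    μH[(n : ℝ) - 1] ({x | ¬DifferentiableAt ℝ (gauge K) x} ∩ {x | gauge K x = r}) = 0 := by
  obtain ⟨L, hL⟩ := hK.lipschitz_gauge h0
  have hd : (0 : ℝ) ≤ n - 1 := by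
    have : (1 : ℝ) ≤ n := by exact_mod_cast hn
    linarith
  set N : Set (Euc n) := {x | ¬DifferentiableAt ℝ (gauge K) x} with hN
  have hN0 : μH[(n : ℝ) - 1 + 1] N = 0 := by
    have hvol : volume N = 0 := hL.ae_differentiableAt
    have hH : (μH[(n : ℝ)] : Measure (Euc n)).IsAddHaarMeasure := by
      simpa using isAddHaarMeasure_hausdorffMeasure (E := Euc n)
    rw [sub_add_cancel]
    exact Measure.absolutelyContinuous_isAddHaarMeasure μH[(n : ℝ)] volume hvol
  have hcone : ∀ {x : Euc n} {s : ℝ}, 0 < s → x ∈ N → s • x ∈ N := fun hs hx h =>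
    hx (differentiableAt_gauge_of_smul hs h)
  have h1 : μH[(n : ℝ) - 1] (N ∩ {x | gauge K x = 1}) = 0 := by
    refine hausdorffMeasure_eq_zero_of_slices hL hd hN0 (fun s x => s⁻¹ • x) ?_ ?_
    · intro s hs
      refine LipschitzWith.of_dist_le_mul fun x y => ?_
      rw [dist_smul₀, Real.norm_eq_abs, abs_of_pos (inv_pos.2 (by linarith [hs.1]))]
      gcongr
      simpa using inv_le_one_of_one_le₀ hs.1
    · rintro s hs x ⟨hxN, hx1⟩
      have hs0 : 0 < s := by linarith [hs.1]
      refine ⟨s • x, ⟨hcone hs0 hxN, ?_⟩, inv_smul_smul₀ hs0.ne' x⟩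
      simp only [mem_ofPred_eq] at hx1 ⊢
      rw [gauge_smul_of_nonneg hs0.le, hx1, smul_eq_mul, mul_one]
  have hsub : N ∩ {x | gauge K x = r} ⊆ r • (N ∩ {x | gauge K x = 1}) := by
    rintro x ⟨hxN, hxr⟩
    refine ⟨r⁻¹ • x, ⟨hcone (inv_pos.2 hr) hxN, ?_⟩, smul_inv_smul₀ hr.ne' x⟩
    simp only [mem_ofPred_eq] at hxr ⊢
    rw [gauge_smul_of_nonneg (inv_pos.2 hr).le, hxr, smul_eq_mul, inv_mul_cancel₀ hr.ne']
  refine measure_mono_null hsub ?_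
  rw [Measure.hausdorffMeasure_smul₀ hd hr.ne', h1, smul_zero]

theorem fderiv_gauge_self {E : Type*} [NormedAddCommGroup E] [NormedSpace ℝ E]
    {K : Set E} {x : E} (h : DifferentiableAt ℝ (gauge K) x) :
    fderiv ℝ (gauge K) x x = gauge K x := by
  have h1 : HasDerivAt (fun s : ℝ => gauge K (s • x)) (fderiv ℝ (gauge K) x x) 1 := by
    have h' : HasFDerivAt (gauge K) (fderiv ℝ (gauge K) x) ((1 : ℝ) • x) := by
      simpa using h.hasFDerivAt
    have h'' : HasDerivAt (fun s : ℝ => s • x) x 1 := by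
      simpa using (hasDerivAt_id (1 : ℝ)).smul_const x
    exact h'.comp_hasDerivAt (1 : ℝ) h''
  have h2 : HasDerivAt (fun s : ℝ => gauge K (s • x)) (gauge K x) 1 := by
    have h3 : HasDerivAt (fun s : ℝ => s * gauge K x) (gauge K x) 1 := by
      simpa using (hasDerivAt_id (1 : ℝ)).mul_const (gauge K x)
    refine h3.congr_of_eventuallyEq ?_
    filter_upwards [lt_mem_nhds (zero_lt_one (α := ℝ))] with s hs
    rw [gauge_smul_of_nonneg hs.le, smul_eq_mul]
  exact h1.unique h2

theorem fderiv_gauge_le {E : Type*} [NormedAddCommGroup E] [NormedSpace ℝ E]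
    {K : Set E} (hK : Convex ℝ K) (h0 : K ∈ 𝓝 0) {x : E} (h : DifferentiableAt ℝ (gauge K) x)
    (y : E) : fderiv ℝ (gauge K) x y ≤ gauge K y := by
  have h1 : HasDerivAt (fun s : ℝ => gauge K (x + s • y)) (fderiv ℝ (gauge K) x y) 0 := by
    have h' : HasFDerivAt (gauge K) (fderiv ℝ (gauge K) x) (x + (0 : ℝ) • y) := by
      simpa using h.hasFDerivAt
    have h'' : HasDerivAt (fun s : ℝ => x + s • y) y 0 := by
      simpa using ((hasDerivAt_id (0 : ℝ)).smul_const y).const_add x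
    exact h'.comp_hasDerivAt (0 : ℝ) h''
  refine le_of_tendsto h1.tendsto_slope_zero_right ?_
  filter_upwards [self_mem_nhdsWithin] with s (hs : 0 < s)
  have := gauge_add_le hK (absorbent_nhds_zero h0) x (s • y)
  rw [gauge_smul_of_nonneg hs.le, smul_eq_mul] at this
  simp only [zero_add, zero_smul, add_zero, smul_eq_mul]
  rw [inv_mul_le_iff₀ hs]
  linarith

section Rearrangement

variable {n : ℕ} {u : Euc n → ℝ} {a t : ℝ}

theorem antitone_distFn (u : Euc n → ℝ) : Antitone (distFn u) := fun _ _ h =>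
  measure_mono fun _ (hx : _ < _) => h.trans_lt hx

theorem distFn_lt_top_of_le (ha : distFn u a < ⊤) {τ : ℝ} (hτ : a ≤ τ) : distFn u τ < ⊤ :=
  (antitone_distFn u hτ).trans_lt ha

theorem distFn_le_ofReal_iff {τ s : ℝ} (hτ : distFn u τ < ⊤) (hs : 0 ≤ s) :
    distFn u τ ≤ ENNReal.ofReal s ↔ (distFn u τ).toReal ≤ s :=
  ENNReal.le_ofReal_iff_toReal_le hτ.ne hs

/-- A level of the decreasing rearrangement at which the distribution function is continuous is
attained only at the value of the distribution function. -/
theorem eq_toReal_distFn_of_decRearr_eq (hat : a < t) (ha : distFn u a < ⊤) (ht : t ≠ 0)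
    (hc : ContinuousAt (fun τ => (distFn u τ).toReal) t) {s : ℝ} (hs : 0 ≤ s)
    (h : decRearr u s = t) : s = (distFn u t).toReal := by
  set T : Set ℝ := {τ | distFn u τ ≤ ENNReal.ofReal s} with hT
  have hT0 : sInf T = t := h
  have hne : T.Nonempty := by
    by_contra hcon
    rw [not_nonempty_iff_eq_empty] at hcon
    exact ht (by rw [← hT0, hcon, Real.sInf_empty])
  have hbdd : BddBelow T := by
    by_contra hcon
    exact ht (by rw [← hT0, Real.sInf_of_not_bddBelow hcon])
  refine le_antisymm ?_ ?_
  · refine ge_of_tendsto (hc.tendsto.mono_left (nhdsWithin_le_nhds (s := Iio t))) ?_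
    filter_upwards [Ioo_mem_nhdsLT hat] with τ hτ
    have hτT : τ ∉ T := fun hmem => (csInf_le hbdd hmem).not_gt (hT0 ▸ hτ.2)
    rw [hT, mem_ofPred_eq, distFn_le_ofReal_iff (distFn_lt_top_of_le ha hτ.1.le) hs] at hτT
    exact (not_le.1 hτT).le
  · refine le_of_tendsto (hc.tendsto.mono_left (nhdsWithin_le_nhds (s := Ioi t))) ?_
    filter_upwards [self_mem_nhdsWithin] with τ (hτ : t < τ)
    obtain ⟨b, hb, hbτ⟩ := exists_lt_of_csInf_lt hne (hT0.trans_lt hτ)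
    rw [← distFn_le_ofReal_iff (distFn_lt_top_of_le ha (hat.trans hτ).le) hs]
    exact (antitone_distFn u hbτ.le).trans hb

theorem le_decRearr_and_decRearr_le {s τ₁ τ₂ : ℝ} (ha : distFn u a < ⊤) (h1 : a ≤ τ₁)
    (h2 : a ≤ τ₂) (hs : 0 ≤ s) (hs1 : s < (distFn u τ₁).toReal)
    (hs2 : (distFn u τ₂).toReal ≤ s) : τ₁ ≤ decRearr u s ∧ decRearr u s ≤ τ₂ := by
  have hlow : ∀ b ∈ {τ | distFn u τ ≤ ENNReal.ofReal s}, τ₁ ≤ b := by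
    intro b hb
    by_contra! hlt
    have hb1 := (antitone_distFn u hlt.le).trans hb
    rw [distFn_le_ofReal_iff (distFn_lt_top_of_le ha h1) hs] at hb1
    exact hb1.not_gt hs1
  have hmem : τ₂ ∈ {τ | distFn u τ ≤ ENNReal.ofReal s} :=
    (distFn_le_ofReal_iff (distFn_lt_top_of_le ha h2) hs).2 hs2
  exact ⟨le_csInf ⟨τ₂, hmem⟩ hlow, csInf_le ⟨τ₁, hlow⟩ hmem⟩

/-- The decreasing rearrangement inverts the distribution function at a point where the latter
has nonzero derivative. -/
theorem hasDerivAt_decRearr (hat : a < t) (ha : distFn u a < ⊤) {m' : ℝ} (hm' : m' < 0)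
    (hm : HasDerivAt (fun τ => (distFn u τ).toReal) m' t) (hpos : 0 < (distFn u t).toReal) :
    HasDerivAt (decRearr u) m'⁻¹ (distFn u t).toReal := by
  set m : ℝ → ℝ := fun τ => (distFn u τ).toReal with hmdef
  have hest : ∀ ε > 0, ∃ ρ > 0, ∀ τ, |τ - t| < ρ →
      a < τ ∧ |m τ - m t - m' * (τ - t)| ≤ ε * |τ - t| := by
    intro ε hε
    have h1 := hm.isLittleO.def hε
    obtain ⟨ρ, hρ, hball⟩ := Metric.eventually_nhds_iff.1 (h1.and (lt_mem_nhds hat))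
    refine ⟨ρ, hρ, fun τ hτ => ?_⟩
    have := hball (y := τ) (by rwa [Real.dist_eq])
    simp only [Real.norm_eq_abs, smul_eq_mul] at this
    exact ⟨this.2, by rw [mul_comm m']; exact this.1⟩
  have hval : decRearr u (m t) = t := by
    obtain ⟨ρ, hρ, hball⟩ := hest (-m' / 2) (by linarith)
    refine eq_of_forall_dist_le fun η hη => ?_
    set η' := min η (ρ / 2) with hη'
    have hη0 : 0 < η' := lt_min hη (by linarith)
    have hηρ : η' < ρ := (min_le_right _ _).trans_lt (by linarith)
    have hL := hball (t - η') (by rw [show t - η' - t = -η' by ring, abs_neg, abs_of_pos hη0]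
                                  exact hηρ)
    rw [show t - η' - t = -η' by ring, abs_neg η', abs_of_pos hη0] at hL
    have hL2 := abs_le.1 hL.2
    have hneg : m' * η' < 0 := mul_neg_of_neg_of_pos hm' hη0
    obtain ⟨h1, h2⟩ := le_decRearr_and_decRearr_le (s := m t) (τ₁ := t - η') (τ₂ := t) ha hL.1.le
      hat.le hpos.le (by change m t < m (t - η'); linarith) le_rfl
    rw [Real.dist_eq, abs_le]
    have := min_le_left η (ρ / 2)
    constructor <;> linarith
  rw [hasDerivAt_iff_isLittleO, Asymptotics.isLittleO_iff]
  intro c hc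
  set k : ℝ := -m'⁻¹ with hk
  have hk0 : 0 < k := by rw [hk]; exact neg_pos.2 (inv_lt_zero.2 hm')
  have hmk : m' * k = -1 := by rw [hk, mul_neg, mul_inv_cancel₀ hm'.ne]
  obtain ⟨ρ, hρ, hball⟩ := hest (-m' * c / (2 * (k + c))) (div_pos (by nlinarith) (by positivity))
  have hev : ∀ᶠ s in 𝓝 (m t), |s - m t| < ρ / (k + c) := by
    have := Metric.ball_mem_nhds (m t) (div_pos hρ (add_pos hk0 hc))
    filter_upwards [this] with s hs
    rwa [Metric.mem_ball, Real.dist_eq] at hs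
  filter_upwards [hev, lt_mem_nhds hpos] with s hs hs0
  rw [hval, Real.norm_eq_abs, Real.norm_eq_abs, smul_eq_mul]
  rcases eq_or_ne s (m t) with rfl | hne
  · have hval' : decRearr u (distFn u t).toReal = t := hval
    simp [m, hval']
  set δ := s - m t with hδ
  have hδ0 : 0 < |δ| := abs_pos.2 (sub_ne_zero.2 hne)
  have hsδ : s = m t + δ := by rw [hδ]; ring
  rw [lt_div_iff₀ (by positivity)] at hs
  have hbound : ∀ θ : ℝ, |θ| = c * |δ| → |(t - k * δ + θ) - t| ≤ (k + c) * |δ| := by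
    intro θ hθ
    calc |(t - k * δ + θ) - t| = |-(k * δ) + θ| := by ring_nf
      _ ≤ |-(k * δ)| + |θ| := abs_add_le _ _
      _ = (k + c) * |δ| := by rw [abs_neg, abs_mul, abs_of_pos hk0, hθ]; ring
  have hest2 : ∀ θ : ℝ, |θ| = c * |δ| → a < t - k * δ + θ ∧
      |m (t - k * δ + θ) - m t - (δ + m' * θ)| ≤ -m' * c / 2 * |δ| := by
    intro θ hθ
    have h1 := hbound θ hθ
    obtain ⟨h2, h3⟩ := hball _ (h1.trans_lt (by linarith))
    refine ⟨h2, ?_⟩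
    rw [show δ + m' * θ = m' * (t - k * δ + θ - t) by linear_combination δ * hmk]
    refine h3.trans ?_
    calc -m' * c / (2 * (k + c)) * |t - k * δ + θ - t|
        ≤ -m' * c / (2 * (k + c)) * ((k + c) * |δ|) := by
          refine mul_le_mul_of_nonneg_left h1 (div_nonneg (by nlinarith) (by positivity))
      _ = -m' * c / 2 * |δ| := by field_simp
  obtain ⟨hp1, hp2⟩ := hest2 (c * |δ|) (by rw [abs_mul, abs_abs, abs_of_pos hc])
  obtain ⟨hq1, hq2⟩ := hest2 (-(c * |δ|)) (by rw [abs_neg, abs_mul, abs_abs, abs_of_pos hc])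
  have hmc : 0 < -m' * c * |δ| := by have := mul_pos (mul_pos (neg_pos.2 hm') hc) hδ0; linarith
  have hp3 := abs_le.1 hp2
  have hq3 := abs_le.1 hq2
  obtain ⟨h1, h2⟩ := le_decRearr_and_decRearr_le (s := s) ha hq1.le hp1.le hs0.le
    (by change s < m _; nlinarith) (by change m _ ≤ s; nlinarith)
  rw [show m'⁻¹ = -k by rw [hk, neg_neg], abs_le]
  constructor <;> nlinarith

end Rearrangement

section Lines

variable {n : ℕ}

theorem quasiMeasurePreserving_add_smul (v : Euc n) :
    Measure.QuasiMeasurePreserving (fun p : ℝ × Euc n => p.2 + p.1 • v)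
      ((volume.restrict (Ioc (0 : ℝ) 1)).prod volume) volume :=
  QuasiMeasurePreserving.prod_of_right (by fun_prop) <| Eventually.of_forall fun τ =>
    (measurePreserving_add_right volume (τ • v)).quasiMeasurePreserving

theorem integrable_add_smul {F : Type*} [NormedAddCommGroup F] {f : Euc n → F}
    (hf : Integrable f) (v : Euc n) :
    Integrable (fun p : ℝ × Euc n => f (p.2 + p.1 • v))
      ((volume.restrict (Ioc (0 : ℝ) 1)).prod volume) := by
  have hm : AEStronglyMeasurable (fun p : ℝ × Euc n => f (p.2 + p.1 • v))
      ((volume.restrict (Ioc (0 : ℝ) 1)).prod volume) :=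
    hf.1.comp_quasiMeasurePreserving (quasiMeasurePreserving_add_smul v)
  rw [integrable_prod_iff hm]
  refine ⟨Eventually.of_forall fun τ => hf.comp_add_right (τ • v), ?_⟩
  simp only [integral_add_right_eq_self (μ := (volume : Measure (Euc n))) (fun x => ‖f x‖)]
  exact integrable_const _

/-- The fundamental theorem of calculus for weakly differentiable functions. -/
theorem ae_sub_eq_integral_weakGradient {u : Euc n → ℝ} {g : Euc n → Euc n}
    (hu : HasWeakGradient u g) (hg : Integrable g) (v : Euc n) :
    ∀ᵐ x, u (x + v) - u x = ∫ τ in (0 : ℝ)..1, ⟪g (x + τ • v), v⟫ := by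
  obtain ⟨hul, -, hweak⟩ := hu
  have hgv : Integrable (fun x => ⟪g x, v⟫) := hg.inner_const v
  have hprod := integrable_add_smul hgv v
  have huv : LocallyIntegrable (fun x => u (x + v)) := by
    have h1 : Measure.map (Homeomorph.addRight v) (volume : Measure (Euc n)) = volume :=
      (measurePreserving_add_right volume v).map_eq
    have h2 : LocallyIntegrable u (Measure.map (Homeomorph.addRight v) volume) := by rwa [h1]
    exact (locallyIntegrable_map_homeomorph _).1 h2
  refine ae_eq_of_integral_contDiff_smul_eq (huv.sub hul) ?_ ?_
  · refine Integrable.locallyIntegrable ?_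
    simp only [intervalIntegral.integral_of_le zero_le_one]
    exact hprod.integral_prod_right
  intro φ hφ hφc
  have hφcont : Continuous φ := hφ.continuous
  have hdφ : Continuous (fderiv ℝ φ) := hφ.continuous_fderiv (by simp)
  obtain ⟨M, hM⟩ := hφcont.bounded_above_of_compact_support hφc
  obtain ⟨M', hM'⟩ := hdφ.bounded_above_of_compact_support (hφc.fderiv ℝ)
  have hrhs : ∫ x, φ x • ∫ τ in (0 : ℝ)..1, ⟪g (x + τ • v), v⟫ =
      ∫ τ in Ioc (0 : ℝ) 1, ∫ x, φ x * ⟪g (x + τ • v), v⟫ := by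
    rw [integral_integral_swap]
    · refine integral_congr_ae (Eventually.of_forall fun x => ?_)
      simp only [smul_eq_mul]
      rw [intervalIntegral.integral_of_le zero_le_one, integral_const_mul]
    · exact hprod.bdd_mul (by fun_prop) (Eventually.of_forall fun p => hM p.2)
  have hslice : ∀ τ : ℝ, ∫ x, φ x * ⟪g (x + τ • v), v⟫ =
      -∫ x, u x * fderiv ℝ φ (x - τ • v) v := by
    intro τ
    have h1 : ∫ x, φ x * ⟪g (x + τ • v), v⟫ = ∫ x, ⟪g x, v⟫ * φ (x - τ • v) := by
      rw [← integral_add_right_eq_self (fun x => ⟪g x, v⟫ * φ (x - τ • v)) (τ • v)]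
      simp only [add_sub_cancel_right, mul_comm]
    have h2 := hweak (fun x => φ (x - τ • v)) (hφ.comp (contDiff_id.sub contDiff_const))
      (hφc.comp_homeomorph (Homeomorph.subRight (τ • v))) v
    simp only [fderiv_comp_sub] at h2
    rw [h1, h2, neg_neg]
  obtain ⟨R, hR⟩ := hφc.isCompact.isBounded.subset_closedBall (0 : Euc n)
  set B : Set (Euc n) := Metric.closedBall 0 (R + ‖v‖) with hB
  have hBm : MeasurableSet B := Metric.isClosed_closedBall.measurableSet
  have huB : Integrable (B.indicator u) :=
    (integrable_indicator_iff hBm).2 (hul.integrableOn_isCompact (isCompact_closedBall _ _))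
  have hDzero : ∀ τ ∈ Ioc (0 : ℝ) 1, ∀ x ∉ B, fderiv ℝ φ (x - τ • v) = 0 := by
    intro τ hτ x hx
    by_contra hne
    have hx' := hR (support_fderiv_subset ℝ (f := φ) hne)
    rw [mem_closedBall_zero_iff] at hx'
    refine hx (mem_closedBall_zero_iff.2 ?_)
    calc ‖x‖ = ‖(x - τ • v) + τ • v‖ := by rw [sub_add_cancel]
      _ ≤ ‖x - τ • v‖ + ‖τ • v‖ := norm_add_le _ _
      _ ≤ R + ‖v‖ := by
        rw [norm_smul, Real.norm_eq_abs, abs_of_pos hτ.1]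
        exact add_le_add hx' (mul_le_of_le_one_left (norm_nonneg _) hτ.2)
  have h_int : Integrable (fun p : ℝ × Euc n => u p.2 * fderiv ℝ φ (p.2 - p.1 • v) v)
      ((volume.restrict (Ioc (0 : ℝ) 1)).prod volume) := by
    have h1 : Integrable (fun p : ℝ × Euc n => B.indicator u p.2 * fderiv ℝ φ (p.2 - p.1 • v) v)
        ((volume.restrict (Ioc (0 : ℝ) 1)).prod volume) := by
      refine (huB.comp_snd (volume.restrict (Ioc (0 : ℝ) 1))).mul_bdd (c := M' * ‖v‖) ?_ ?_
      · exact Continuous.aestronglyMeasurable (by fun_prop)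
      · exact Eventually.of_forall fun p => (fderiv ℝ φ (p.2 - p.1 • v)).le_of_opNorm_le (hM' _) v
    refine h1.congr ?_
    have h2 : ∀ᵐ p ∂((volume.restrict (Ioc (0 : ℝ) 1)).prod (volume : Measure (Euc n))),
        p.1 ∈ Ioc (0 : ℝ) 1 :=
      Measure.quasiMeasurePreserving_fst.ae (ae_restrict_mem measurableSet_Ioc)
    filter_upwards [h2] with p hp
    by_cases hx : p.2 ∈ B
    · rw [indicator_of_mem hx]
    · simp [indicator_of_notMem hx, hDzero p.1 hp p.2 hx]
  have hFTC : ∀ x, φ (x - v) - φ x = -∫ τ in Ioc (0 : ℝ) 1, fderiv ℝ φ (x - τ • v) v := by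
    intro x
    have hd : ∀ τ : ℝ, HasDerivAt (fun τ : ℝ => φ (x - τ • v)) (-fderiv ℝ φ (x - τ • v) v) τ := by
      intro τ
      have h1 : HasDerivAt (fun τ : ℝ => x - τ • v) (-v) τ := by
        simpa using ((hasDerivAt_id τ).smul_const v).const_sub x
      have h2 := ((hφ.differentiable (by simp)) (x - τ • v)).hasFDerivAt.comp_hasDerivAt τ h1
      rw [map_neg] at h2
      exact h2
    have hc : Continuous fun τ : ℝ => -fderiv ℝ φ (x - τ • v) v := by fun_prop
    have := intervalIntegral.integral_eq_sub_of_hasDerivAt (a := 0) (b := 1)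
      (fun τ _ => hd τ) (hc.intervalIntegrable 0 1)
    rw [intervalIntegral.integral_of_le zero_le_one, integral_neg] at this
    simpa using this.symm
  have hφu : Integrable (fun x => φ x * u x) :=
    hul.integrable_smul_left_of_hasCompactSupport hφcont hφc
  have hφuv : Integrable (fun x => φ x * u (x + v)) :=
    huv.integrable_smul_left_of_hasCompactSupport hφcont hφc
  have hφvu : Integrable (fun x => φ (x - v) * u x) :=
    hul.integrable_smul_left_of_hasCompactSupport (by fun_prop : Continuous fun x => φ (x - v))
      (hφc.comp_homeomorph (Homeomorph.subRight v))
  calc ∫ x, φ x • (u (x + v) - u x) = (∫ x, φ x * u (x + v)) - ∫ x, φ x * u x := by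
        rw [← integral_sub hφuv hφu]; simp only [smul_eq_mul, mul_sub]
    _ = (∫ x, φ (x - v) * u x) - ∫ x, φ x * u x := by
        rw [← integral_add_right_eq_self (fun x => φ (x - v) * u x) v]
        simp only [add_sub_cancel_right]
    _ = ∫ x, -∫ τ in Ioc (0 : ℝ) 1, u x * fderiv ℝ φ (x - τ • v) v := by
        rw [← integral_sub hφvu hφu]
        refine integral_congr_ae (Eventually.of_forall fun x => ?_)
        simp only
        rw [integral_const_mul, ← mul_neg, ← hFTC x]; ring
    _ = ∫ τ in Ioc (0 : ℝ) 1, -∫ x, u x * fderiv ℝ φ (x - τ • v) v := by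
        rw [integral_neg, integral_neg]
        congr 1
        exact (integral_integral_swap h_int).symm
    _ = ∫ x, φ x • ∫ τ in (0 : ℝ)..1, ⟪g (x + τ • v), v⟫ := by
        rw [hrhs]; simp only [hslice]

theorem HasWeakGradient.congr_ae {u : Euc n → ℝ} {g g' : Euc n → Euc n}
    (hu : HasWeakGradient u g) (h : g =ᵐ[volume] g') : HasWeakGradient u g' := by
  refine ⟨hu.1, hu.2.1.congr h, fun φ hφ hφc v => ?_⟩
  rw [hu.2.2 φ hφ hφc v]
  congr 1
  refine integral_congr_ae ?_
  filter_upwards [h] with x hx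
  simp only [hx]

/-- If a weakly differentiable function almost never takes values in `A`, then `A` has no mass
between the values of the function at almost any two points. -/
theorem ae_volume_inter_uIcc_eq_zero {u : Euc n → ℝ} (hum : Measurable u) {g : Euc n → Euc n}
    (hu : HasWeakGradient u g) (hg : Integrable g) {A : Set ℝ} (hA : volume (u ⁻¹' A) = 0)
    (v : Euc n) : ∀ᵐ x, volume (A ∩ uIcc (u x) (u (x + v))) = 0 := by
  wlog hgm : StronglyMeasurable g generalizing g
  · exact this (hu.congr_ae hg.1.ae_eq_mk) (hg.congr hg.1.ae_eq_mk) hg.1.stronglyMeasurable_mk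
  have hline : ∀ᵐ x, ∀ᵐ s : ℝ,
      u (x + s • v) - u x = ∫ τ in (0 : ℝ)..1, ⟪g (x + τ • s • v), s • v⟫ := by
    have hmeas : MeasurableSet {p : ℝ × Euc n |
        u (p.2 + p.1 • v) - u p.2 = ∫ τ in (0 : ℝ)..1, ⟪g (p.2 + τ • p.1 • v), p.1 • v⟫} := by
      refine measurableSet_eq_fun
        ((hum.comp (by fun_prop)).sub (hum.comp measurable_snd)) ?_
      simp only [intervalIntegral.integral_of_le zero_le_one]
      refine (StronglyMeasurable.integral_prod_right (ν := volume.restrict (Ioc (0 : ℝ) 1))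
        (f := fun (p : ℝ × Euc n) (τ : ℝ) => ⟪g (p.2 + τ • p.1 • v), p.1 • v⟫) ?_).measurable
      exact StronglyMeasurable.inner (hgm.comp_measurable (by fun_prop))
        (Measurable.stronglyMeasurable (by fun_prop))
    exact (Measure.ae_ae_comm hmeas).1 <| Eventually.of_forall fun s =>
      ae_sub_eq_integral_weakGradient hu hg (s • v)
  have havoid : ∀ᵐ x : Euc n, ∀ᵐ s ∂(volume.restrict (Ioc (0 : ℝ) 1)), u (x + s • v) ∉ A := by
    have h1 : ∀ᵐ p ∂((volume.restrict (Ioc (0 : ℝ) 1)).prod (volume : Measure (Euc n))),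
        u (p.2 + p.1 • v) ∉ A :=
      (quasiMeasurePreserving_add_smul v).ae (p := fun y => u y ∉ A)
        (measure_eq_zero_iff_ae_notMem.1 hA)
    have h2 : ∀ᵐ q ∂((volume : Measure (Euc n)).prod (volume.restrict (Ioc (0 : ℝ) 1))),
        u (q.1 + q.2 • v) ∉ A :=
      (Measure.measurePreserving_swap (μ := (volume : Measure (Euc n)))
        (ν := volume.restrict (Ioc (0 : ℝ) 1))).quasiMeasurePreserving.ae h1
    exact Measure.ae_ae_of_ae_prod h2
  have hgv : Integrable fun x => ⟪g x, v⟫ := hg.inner_const v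
  have hsec : ∀ᵐ x : Euc n, Integrable (fun σ : ℝ => ⟪g (x + σ • v), v⟫)
      (volume.restrict (Ioc (0 : ℝ) 1)) := (integrable_add_smul hgv v).prod_left_ae
  filter_upwards [hline, havoid, hsec, ae_sub_eq_integral_weakGradient hu hg v]
    with x hx1 hx2 hx3 hx4
  set F : ℝ → ℝ := fun σ => ⟪g (x + σ • v), v⟫ with hF
  set k : ℝ → ℝ := (Ioc (0 : ℝ) 1).indicator F with hk
  have hkint : Integrable k := (integrable_indicator_iff measurableSet_Ioc).2 hx3
  set w : ℝ → ℝ := fun s => u x + ∫ τ in (0 : ℝ)..s, k τ with hw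
  have hFk : ∀ s ∈ Icc (0 : ℝ) 1, ∫ τ in (0 : ℝ)..s, k τ = ∫ τ in (0 : ℝ)..s, F τ := by
    intro s hs
    refine intervalIntegral.integral_congr_ae (Eventually.of_forall fun τ hτ => ?_)
    rw [uIoc_of_le hs.1] at hτ
    exact indicator_of_mem (show τ ∈ Ioc (0 : ℝ) 1 from ⟨hτ.1, hτ.2.trans hs.2⟩) F
  have hscale : ∀ s : ℝ, ∫ τ in (0 : ℝ)..1, ⟪g (x + τ • s • v), s • v⟫
      = ∫ τ in (0 : ℝ)..s, F τ := by
    intro s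
    have := intervalIntegral.smul_integral_comp_mul_right (a := 0) (b := 1) F s
    rw [zero_mul, one_mul] at this
    rw [← this, smul_eq_mul, ← intervalIntegral.integral_const_mul]
    simp only [hF, smul_smul, inner_smul_right]
  have hw0 : w 0 = u x := by simp [hw]
  have hw1 : w 1 = u (x + v) := by
    rw [hw]
    simp only
    rw [hFk 1 (by simp), ← hx4, add_sub_cancel]
  have hwc : Continuous w :=
    continuous_const.add (intervalIntegral.continuous_primitive
      (fun a b => hkint.intervalIntegrable) 0)
  have hE : volume (Icc (0 : ℝ) 1 ∩ w ⁻¹' A) = 0 := by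
    have h1 : ∀ᵐ s : ℝ, s ∈ Ioc (0 : ℝ) 1 → w s ∉ A := by
      filter_upwards [(ae_restrict_iff' measurableSet_Ioc).1 hx2, hx1] with s hs2 hs1 hs
      have : w s = u (x + s • v) := by
        rw [hw]
        simp only
        rw [hFk s ⟨hs.1.le, hs.2⟩, ← hscale s, ← hs1, add_sub_cancel]
      rw [this]
      exact hs2 hs
    rw [measure_eq_zero_iff_ae_notMem]
    filter_upwards [h1, Measure.ae_ne volume (0 : ℝ)] with s hs hs0 hmem
    exact hs ⟨lt_of_le_of_ne hmem.1.1 hs0.symm, hmem.1.2⟩ hmem.2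
  refine measure_mono_null ?_ (volume_image_primitive_eq_zero hkint (u x) hE)
  rintro y ⟨hyA, hy⟩
  rw [← hw0, ← hw1] at hy
  obtain ⟨s, hs, rfl⟩ := intermediate_value_uIcc hwc.continuousOn hy
  rw [uIcc_of_le zero_le_one] at hs
  exact ⟨s, ⟨hs, hyA⟩, rfl⟩

theorem volume_eq_zero_of_volume_preimage_eq_zero {u : Euc n → ℝ} (hum : Measurable u)
    {g : Euc n → Euc n} (hu : HasWeakGradient u g) (hg : Integrable g) {a b : ℝ}
    (ha : volume {x | u x < a} ≠ 0) (hb : volume {x | b < u x} ≠ 0) {A : Set ℝ}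
    (hAab : A ⊆ Ioo a b) (hA : volume (u ⁻¹' A) = 0) : volume A = 0 := by
  by_contra hA0
  have h1 : ∀ v : Euc n, ∀ᵐ x, ¬(u x < a ∧ b < u (x + v)) := by
    intro v
    filter_upwards [ae_volume_inter_uIcc_eq_zero hum hu hg hA v] with x hx hux
    have hsub : A ⊆ A ∩ uIcc (u x) (u (x + v)) := fun y hy =>
      ⟨hy, Icc_subset_uIcc ⟨(hux.1.trans (hAab hy).1).le, ((hAab hy).2.trans hux.2).le⟩⟩
    exact hA0 (measure_mono_null hsub hx)
  have hmeas : MeasurableSet {p : Euc n × Euc n | ¬(u p.2 < a ∧ b < u (p.2 + p.1))} := by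
    refine MeasurableSet.compl (MeasurableSet.inter ?_ ?_)
    · exact measurableSet_lt (hum.comp measurable_snd) measurable_const
    · exact measurableSet_lt measurable_const (hum.comp (by fun_prop))
  have h2 : ∀ᵐ x : Euc n, ∀ᵐ v : Euc n, ¬(u x < a ∧ b < u (x + v)) :=
    (Measure.ae_ae_comm (p := fun v x : Euc n => ¬(u x < a ∧ b < u (x + v))) hmeas).1
      (Eventually.of_forall h1)
  refine ha (measure_eq_zero_iff_ae_notMem.2 ?_)
  filter_upwards [h2] with x hx hxa
  refine hb ?_
  rw [← measure_preimage_add volume x {y | b < u y}, measure_eq_zero_iff_ae_notMem]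
  filter_upwards [hx] with v hv hvb
  exact hv ⟨hxa, hvb⟩

end Lines

theorem ae_exists_neg_hasDerivAt_distFn {n : ℕ} {u : Euc n → ℝ} {g : Euc n → Euc n}
    (hu : HasWeakGradient u g) (hg : Integrable g) (hud : MemMd u) :
    ∀ᵐ t : ℝ, eInf u < (t : EReal) → (t : EReal) < eSup u →
      ∃ m' < 0, HasDerivAt (fun τ => (distFn u τ).toReal) m' t := by
  obtain ⟨hum, hfin⟩ := hud
  set m : ℝ → ℝ := fun τ => (distFn u τ).toReal with hm
  set S : Set ℝ := {τ | eInf u < (τ : EReal)} with hS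
  have hSo : IsOpen S := isOpen_Ioi.preimage continuous_coe_real_ereal
  have hanti : AntitoneOn m S := fun a ha b _ hab =>
    ENNReal.toReal_mono (hfin a ha).ne (antitone_distFn u hab)
  have hdiff : ∀ᵐ t : ℝ, t ∈ S → DifferentiableAt ℝ m t := by
    filter_upwards [hanti.neg.ae_differentiableWithinAt_of_mem] with t ht htS
    have h1 := (ht htS).differentiableAt (hSo.mem_nhds htS)
    simpa using h1.neg
  have hzero : ∀ᵐ t : ℝ, ∀ p : ℚ × ℚ, eInf u < ((p.1 : ℝ) : EReal) →
      ((p.2 : ℝ) : EReal) < eSup u → t ∈ Ioo (p.1 : ℝ) p.2 → ¬HasDerivAt m 0 t := by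
    rw [ae_all_iff]
    rintro ⟨a, b⟩
    simp only
    by_cases ha : eInf u < ((a : ℝ) : EReal)
    swap
    · simp [ha]
    by_cases hb : ((b : ℝ) : EReal) < eSup u
    swap
    · simp [hb]
    have h1 := volume_eq_zero_of_volume_preimage_eq_zero hum hu hg (a := a) (b := b)
      (A := {t | t ∈ Ioo (a : ℝ) b ∧ HasDerivAt m 0 t})
      (fun h0 => by
        refine ha.not_ge (le_essInf_of_ae_le _ ?_)
        filter_upwards [measure_eq_zero_iff_ae_notMem.1 h0] with x hx
        exact EReal.coe_le_coe_iff.2 (not_lt.1 hx))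
      (fun h0 => by
        refine hb.not_ge (essSup_le_of_ae_le _ ?_)
        filter_upwards [measure_eq_zero_iff_ae_notMem.1 h0] with x hx
        exact EReal.coe_le_coe_iff.2 (not_lt.1 hx))
      (fun t ht => ht.1)
      (volume_preimage_eq_zero_of_hasDerivAt_zero hum (hfin a ha) (fun t ht => ht.1)
        fun t ht => ht.2)
    filter_upwards [measure_eq_zero_iff_ae_notMem.1 h1] with t ht _ _ htab hd
    exact ht ⟨htab, hd⟩
  filter_upwards [hdiff, hzero] with t hd hz ht1 ht2
  have hd' := (hd ht1).hasDerivAt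
  obtain ⟨a, ha1, ha2⟩ := EReal.lt_iff_exists_rat_btwn.1 ht1
  obtain ⟨b, hb1, hb2⟩ := EReal.lt_iff_exists_rat_btwn.1 ht2
  have hne : deriv m t ≠ 0 := fun h0 =>
    hz (a, b) ha1 hb2 ⟨EReal.coe_lt_coe_iff.1 ha2, EReal.coe_lt_coe_iff.1 hb1⟩ (h0 ▸ hd')
  have hle : deriv m t ≤ 0 := by
    rw [← derivWithin_of_isOpen hSo ht1]
    exact hanti.derivWithin_nonpos
  exact ⟨_, lt_of_le_of_ne hle hne, hd'⟩

theorem hasFDerivAt_funcSymm {n : ℕ} {K : Set (Euc n)} {u : Euc n → ℝ} {x : Euc n} {D : ℝ}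
    (hD : HasDerivAt (decRearr u) D ((volume K).toReal * gauge K x ^ n))
    (hx : DifferentiableAt ℝ (gauge K) x) :
    HasFDerivAt (funcSymm K u)
      ((D * ((volume K).toReal * (n * gauge K x ^ (n - 1)))) • fderiv ℝ (gauge K) x) x := by
  have h1 : HasDerivAt (fun ρ : ℝ => decRearr u ((volume K).toReal * ρ ^ n))
      (D * ((volume K).toReal * (n * gauge K x ^ (n - 1)))) (gauge K x) :=
    HasDerivAt.comp (h₂ := decRearr u) (h := fun ρ : ℝ => (volume K).toReal * ρ ^ n)
      (gauge K x) hD ((hasDerivAt_pow n (gauge K x)).const_mul _)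
  exact h1.comp_hasFDerivAt x hx.hasFDerivAt

theorem inner_gradient_eq_fderiv {n : ℕ} {f : Euc n → ℝ} (x y : Euc n) :
    ⟪gradient f x, y⟫ = fderiv ℝ f x y :=
  InnerProductSpace.toDual_symm_apply

/-- The support function of a set described by `H₀^K(-η)` takes the same value at negative
multiples of gradients of `H₀^K` taken at points of the same level set. -/
theorem suppFnR_eq_of_inner_eq_fderiv_gauge {n : ℕ} {K : Set (Euc n)} (hK : Convex ℝ K)
    (h0 : K ∈ 𝓝 0) {S : Set (Euc n)}
    (hS : ∀ η η', gauge K (-η) = gauge K (-η') → η ∈ S → η' ∈ S) {x₁ x₂ p₁ p₂ : Euc n} {C r : ℝ}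
    (hC : 0 ≤ C) (hr : 0 < r) (hx₁ : gauge K x₁ = r) (hx₂ : gauge K x₂ = r)
    (hd₁ : DifferentiableAt ℝ (gauge K) x₁) (hd₂ : DifferentiableAt ℝ (gauge K) x₂)
    (hp₁ : ∀ y, ⟪p₁, y⟫ = -C * fderiv ℝ (gauge K) x₁ y)
    (hp₂ : ∀ y, ⟪p₂, y⟫ = -C * fderiv ℝ (gauge K) x₂ y) :
    suppFnR S p₁ = suppFnR S p₂ := by
  have key : ∀ {y z p q : Euc n}, gauge K z = r → DifferentiableAt ℝ (gauge K) y →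
      DifferentiableAt ℝ (gauge K) z → (∀ η, ⟪p, η⟫ = -C * fderiv ℝ (gauge K) y η) →
      (∀ η, ⟪q, η⟫ = -C * fderiv ℝ (gauge K) z η) →
      ∀ a ∈ (fun η => ⟪p, η⟫) '' S, ∃ b ∈ (fun η => ⟪q, η⟫) '' S, a ≤ b := by
    rintro y z p q hz hdy hdz hp hq _ ⟨η, hη, rfl⟩
    set d := gauge K (-η) with hd
    have hdr : 0 ≤ d / r := div_nonneg (gauge_nonneg _) hr.le
    refine ⟨_, ⟨-((d / r) • z), hS η _ ?_ hη, rfl⟩, ?_⟩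
    · rw [neg_neg, gauge_smul_of_nonneg hdr, hz, smul_eq_mul, div_mul_cancel₀ _ hr.ne']
    · have h1 := fderiv_gauge_le hK h0 hdy (-η)
      rw [map_neg] at h1
      have h2 : d / r * r = d := div_mul_cancel₀ _ hr.ne'
      simp only [hp, hq, map_neg, map_smul, fderiv_gauge_self hdz, hz, smul_eq_mul, h2]
      nlinarith [mul_le_mul_of_nonneg_left h1 hC]
  exact csSup_eq_csSup_of_forall_exists_le (key hx₂ hd₁ hd₂ hp₁ hp₂) (key hx₁ hd₂ hd₁ hp₂ hp₁)

/-- **Lemma (constancy of `h_{{Φ_{•K} ≤ s}}(∇u^K)` on level sets of `u^K`).** -/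
theorem statement17 {n : ℕ} (hn : 1 ≤ n) (K : Set (Euc n)) (hK : IsConvexBody K)
    (h0K : (0 : Euc n) ∈ interior K)
    (Φ : Euc n → ℝ≥0∞) (hΦ : IsNYoung Φ)
    (u : Euc n → ℝ) (gu : Euc n → Euc n)
    (hu : MemV1d (fun ξ : Euc n => ENNReal.ofReal ‖ξ‖) u gu) :
    ∀ᵐ t : ℝ ∂volume, eInf u < (t : EReal) → (t : EReal) < eSup u →
      (∀ᵐ x ∂(μH[(n : ℝ) - 1]).restrict {x | funcSymm K u x = t},
        DifferentiableAt ℝ (funcSymm K u) x ∧ gradient (funcSymm K u) x ≠ 0) ∧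
      ∀ s : ℝ, 0 ≤ s →
        ∀ᵐ x₁ ∂(μH[(n : ℝ) - 1]).restrict {x | funcSymm K u x = t},
          ∀ᵐ x₂ ∂(μH[(n : ℝ) - 1]).restrict {x | funcSymm K u x = t},
            suppFnR {η : Euc n | youngSymm K (yconj Φ) η ≤ ENNReal.ofReal s}
                (gradient (funcSymm K u) x₁) =
              suppFnR {η : Euc n | youngSymm K (yconj Φ) η ≤ ENNReal.ofReal s}
                (gradient (funcSymm K u) x₂) := by
  obtain ⟨hgrad, hud, hgfin⟩ := hu
  have hg : Integrable gu := by
    refine ⟨hgrad.2.1.aestronglyMeasurable, ?_⟩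
    simpa only [HasFiniteIntegral, ofReal_norm] using hgfin
  have hKn : K ∈ 𝓝 0 := mem_interior_iff_mem_nhds.1 h0K
  have hKc : Convex ℝ K := hK.2
  have hn0 : n ≠ 0 := by omega
  have hV : 0 < (volume K).toReal :=
    ENNReal.toReal_pos (Measure.measure_pos_of_mem_nhds volume hKn).ne' hK.1.measure_lt_top.ne
  filter_upwards [ae_exists_neg_hasDerivAt_distFn hgrad hg hud, Measure.ae_ne volume (0 : ℝ)]
    with t htd ht0 ht1 ht2
  obtain ⟨m', hm', hm⟩ := htd ht1 ht2
  obtain ⟨a, ha1, ha2⟩ := EReal.lt_iff_exists_real_btwn.1 ht1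
  have hat : a < t := EReal.coe_lt_coe_iff.1 ha2
  have ha : distFn u a < ⊤ := hud.2 a ha1
  have hpos : 0 < (distFn u t).toReal := by
    refine ENNReal.toReal_pos (fun h0 => ?_) (hud.2 t ht1).ne
    refine ht2.not_ge (essSup_le_of_ae_le _ ?_)
    filter_upwards [measure_eq_zero_iff_ae_notMem.1 h0] with x hx
    exact EReal.coe_le_coe_iff.2 (not_lt.1 hx)
  have hD := hasDerivAt_decRearr hat ha hm' hm hpos
  have hlevel : ∀ x, funcSymm K u x = t → (volume K).toReal * gauge K x ^ n = (distFn u t).toReal :=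
    fun x hx => eq_toReal_distFn_of_decRearr_eq hat ha ht0 hm.continuousAt
      (mul_nonneg hV.le (pow_nonneg (gauge_nonneg x) n)) hx
  rcases {x | funcSymm K u x = t}.eq_empty_or_nonempty with hempty | ⟨x₀, hx₀⟩
  · simp [hempty]
  set r := gauge K x₀ with hr
  have hVr : (volume K).toReal * r ^ n = (distFn u t).toReal := hlevel x₀ hx₀
  have hr0 : 0 < r := by
    refine (gauge_nonneg x₀).lt_of_ne fun h0 => ?_
    rw [hr, ← h0, zero_pow hn0, mul_zero] at hVr
    exact hpos.ne hVr
  have hsub : {x | funcSymm K u x = t} ⊆ {x | gauge K x = r} := fun x hx =>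
    (pow_left_inj₀ (gauge_nonneg x) hr0.le hn0).1
      (mul_left_cancel₀ hV.ne' ((hlevel x hx).trans hVr.symm))
  have hgood : ∀ᵐ x ∂(μH[(n : ℝ) - 1]).restrict {x | funcSymm K u x = t},
      gauge K x = r ∧ DifferentiableAt ℝ (gauge K) x := by
    have hmeas : MeasurableSet {x | gauge K x = r} :=
      (isClosed_singleton.preimage (continuous_gauge hKc hKn)).measurableSet
    have hlev : ∀ᵐ x ∂(μH[(n : ℝ) - 1]).restrict {x | gauge K x = r},
        gauge K x = r ∧ DifferentiableAt ℝ (gauge K) x := by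
      rw [ae_restrict_iff' hmeas]
      filter_upwards [measure_eq_zero_iff_ae_notMem.1
        (hausdorffMeasure_not_differentiableAt_gauge_eq_zero hn hKc hKn hr0)] with x hx hxr
      exact ⟨hxr, by_contra fun hnd => hx ⟨hnd, hxr⟩⟩
    exact ae_mono (Measure.restrict_mono hsub le_rfl) hlev
  set C := -(m'⁻¹ * ((volume K).toReal * (n * r ^ (n - 1)))) with hC
  have hC0 : 0 < C := by
    have hn' : (0 : ℝ) < n := by exact_mod_cast hn
    rw [hC, ← neg_mul]
    exact mul_pos (neg_pos.2 (inv_lt_zero.2 hm')) (by positivity)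
  have hfd : ∀ x, gauge K x = r → DifferentiableAt ℝ (gauge K) x →
      HasFDerivAt (funcSymm K u) ((-C) • fderiv ℝ (gauge K) x) x := by
    intro x hxr hx
    have := hasFDerivAt_funcSymm (K := K) (u := u) (x := x) (D := m'⁻¹)
      (by rw [hxr, hVr]; exact hD) hx
    rwa [hxr, ← neg_neg (m'⁻¹ * _)] at this
  have hinner : ∀ x, gauge K x = r → DifferentiableAt ℝ (gauge K) x → ∀ y,
      ⟪gradient (funcSymm K u) x, y⟫ = -C * fderiv ℝ (gauge K) x y := by
    intro x hxr hx y
    rw [inner_gradient_eq_fderiv, (hfd x hxr hx).fderiv]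
    rfl
  refine ⟨?_, fun s _ => ?_⟩
  · filter_upwards [hgood] with x ⟨hxr, hx⟩
    refine ⟨(hfd x hxr hx).differentiableAt, fun h0 => ?_⟩
    have h1 := hinner x hxr hx x
    rw [h0, inner_zero_left, fderiv_gauge_self hx, hxr] at h1
    nlinarith [mul_pos hC0 hr0]
  · filter_upwards [hgood] with x₁ ⟨hxr₁, hx₁⟩
    filter_upwards [hgood] with x₂ ⟨hxr₂, hx₂⟩
    refine suppFnR_eq_of_inner_eq_fderiv_gauge hKc hKn (fun η η' h hη => ?_) hC0.le hr0 hxr₁ hxr₂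
      hx₁ hx₂ (hinner x₁ hxr₁ hx₁) (hinner x₂ hxr₂ hx₂)
    simp only [mem_ofPred_eq, youngSymm] at hη ⊢
    rwa [← h]

end
end
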